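/- arXiv:1910.04230 — 2 statements merged into one kernel-verified Lean document; each statement's English description precedes it below -/
import Mathlib

section
/- Let Γ be a finite triangle-free simple graph and let S_n denote the path graph with n+1 vertices (the segment of length n). The following are equivalent: (i) S_3 is isomorphic to an induced subgraph of Γ (there exists a graph embedding of S_3 into Γ, i.e., an injective map on vertices such that images are adjacent if and only if the sources are adjacent); (ii) there exists an injective group homomorphism from C(S_3) to C(Γ); (iii) for every n ≥ 0, there exists an injective group homomorphism from C(S_n) to C(Γ). -/
/-- The defining relations of the right-angled Coxeter group of a simple graph:
squares of the generators, and squares of products of generators corresponding to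
adjacent vertices. -/
def racgRels {V : Type*} (G : SimpleGraph V) : Set (FreeGroup V) :=
  {r | (∃ v : V, r = FreeGroup.of v * FreeGroup.of v) ∨
    ∃ u v : V, G.Adj u v ∧ r = (FreeGroup.of u * FreeGroup.of v) ^ 2}

/-- The right-angled Coxeter group of a simple graph. -/
abbrev RACG {V : Type*} (G : SimpleGraph V) : Type _ := PresentedGroup (racgRels G)

/-- The canonical generator of the right-angled Coxeter group corresponding to a vertex. -/
def racgGen {V : Type*} (G : SimpleGraph V) (v : V) : RACG G := PresentedGroup.of v

/-- A reflection of a right-angled Coxeter group: a conjugate of a canonical generator. -/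
def IsReflection {V : Type*} (G : SimpleGraph V) (x : RACG G) : Prop :=
  ∃ (g : RACG G) (v : V), x = g * racgGen G v * g⁻¹

/-- Word length on a right-angled Coxeter group with respect to the canonical generators
(the generators are involutions, so words in the generators suffice). -/
noncomputable def racgLen {V : Type*} (G : SimpleGraph V) (x : RACG G) : ℕ :=
  sInf {n | ∃ l : List V, l.length = n ∧ (l.map (racgGen G)).prod = x}

namespace Monoid.CoprodI

variable {ι : Type*} {G : ι → Type*} [∀ i, Group (G i)]

/-- A list of letters is reduced if it has no trivial letter and adjacent letters come from
distinct factors. -/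
def IsReducedList (L : List (Σ i, G i)) : Prop :=
  (∀ l ∈ L, l.2 ≠ 1) ∧ L.IsChain fun l l' => l.1 ≠ l'.1

/-- The product in the free product of a list of letters. -/
def listProd (L : List (Σ i, G i)) : CoprodI G := (L.map fun l => of l.2).prod

@[simp]
theorem listProd_nil : listProd ([] : List (Σ i, G i)) = 1 := rfl

@[simp]
theorem listProd_cons (x : Σ i, G i) (L : List (Σ i, G i)) :
    listProd (x :: L) = of x.2 * listProd L := by
  simp [listProd]

@[simp]
theorem listProd_append (L M : List (Σ i, G i)) :
    listProd (L ++ M) = listProd L * listProd M := by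
  simp [listProd]

theorem exists_isReducedList (x : CoprodI G) : ∃ L, IsReducedList L ∧ listProd L = x := by
  classical
  exact ⟨(Word.equiv x).toList, ⟨(Word.equiv x).ne_one, (Word.equiv x).chain_ne⟩,
    Word.equiv.symm_apply_apply x⟩

theorem IsReducedList.eq_of_listProd_eq {L M : List (Σ i, G i)} (hL : IsReducedList L)
    (hM : IsReducedList M) (h : listProd L = listProd M) : L = M := by
  classical
  have : (⟨L, hL.1, hL.2⟩ : Word G) = ⟨M, hM.1, hM.2⟩ := Word.equiv.symm.injective h
  exact congrArg Word.toList this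

theorem IsReducedList.tail {x : Σ i, G i} {L : List (Σ i, G i)}
    (h : IsReducedList (x :: L)) : IsReducedList L :=
  ⟨fun l hl => h.1 l (List.mem_cons_of_mem _ hl), h.2.tail⟩

theorem IsReducedList.left_of_append {L M : List (Σ i, G i)}
    (h : IsReducedList (L ++ M)) : IsReducedList L :=
  ⟨fun l hl => h.1 l (List.mem_append_left _ hl), h.2.left_of_append⟩

theorem IsReducedList.append {L M : List (Σ i, G i)} (hL : IsReducedList L)
    (hM : IsReducedList M) (h : ∀ x ∈ L.getLast?, ∀ y ∈ M.head?, x.1 ≠ y.1) :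
    IsReducedList (L ++ M) :=
  ⟨fun l hl => (List.mem_append.1 hl).elim (hL.1 l) (hM.1 l),
    List.isChain_append.2 ⟨hL.2, hM.2, h⟩⟩

theorem isReducedList_singleton {i : ι} {g : G i} (hg : g ≠ 1) :
    IsReducedList [(⟨i, g⟩ : Σ i, G i)] :=
  ⟨by simpa using hg, List.isChain_singleton _⟩

theorem IsReducedList.listProd_mem_range_of_conj {i : ι} (L : List (Σ i, G i))
    (hL : IsReducedList L) (g g' : G i) (hg : g ≠ 1)
    (h : of g * listProd L = listProd L * of g') : ∃ p : G i, listProd L = of p := by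
  induction hn : L.length using Nat.strong_induction_on generalizing L g g' with
  | _ n ih =>
  subst hn
  have hg' : g' ≠ 1 := by
    rintro rfl
    rw [map_one, mul_one, mul_eq_right] at h
    exact hg (of_injective i (h.trans (map_one of).symm))
  rcases L with _ | ⟨⟨j, x⟩, M⟩
  · exact ⟨1, by simp⟩
  by_cases hj : j = i
  · subst hj
    obtain ⟨q, hq⟩ := ih M.length (by simp) M hL.tail (x⁻¹ * g * x) g'
      (fun h0 => hg (by
        calc g = x * (x⁻¹ * g * x) * x⁻¹ := by group
          _ = 1 := by rw [h0]; group)) (by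
        simp only [listProd_cons] at h
        simp only [map_mul, map_inv, mul_assoc]
        rw [h]
        group) rfl
    exact ⟨x * q, by simp [hq]⟩
  obtain ⟨L', ⟨k, y⟩, hL'⟩ := (List.eq_nil_or_concat (⟨j, x⟩ :: M)).resolve_left (by simp)
  rw [List.concat_eq_append] at hL'
  by_cases hk : k = i
  · subst hk
    rw [hL'] at hL h
    obtain ⟨q, hq⟩ := ih L'.length (by simp [hL']) L' hL.left_of_append g (y * g' * y⁻¹) hg
      (by
        simp only [listProd_append, listProd_cons, listProd_nil, mul_one] at h
        simp only [map_mul, map_inv]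
        rw [← mul_assoc] at h
        rw [← mul_assoc, ← mul_assoc, ← h]
        group) rfl
    exact ⟨q * y, by simp [hL', hq]⟩
  · have h1 : IsReducedList ([⟨i, g⟩] ++ (⟨j, x⟩ :: M)) :=
      (isReducedList_singleton hg).append hL (by simpa using Ne.symm hj)
    have h2 : IsReducedList ((⟨j, x⟩ :: M) ++ [⟨i, g'⟩]) :=
      hL.append (isReducedList_singleton hg') (by rw [hL']; simpa using hk)
    have := h1.eq_of_listProd_eq h2 (by simpa [mul_assoc] using h)
    simp only [List.cons_append, List.cons.injEq, Sigma.mk.injEq] at this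
    exact absurd this.1.1.symm hj

/-- In a free product, the centralizer of a nontrivial element of a factor is contained in this
factor. -/
theorem exists_eq_of_of_commute {i : ι} {g : G i} (hg : g ≠ 1) {x : CoprodI G}
    (h : Commute (of g) x) : ∃ p : G i, x = of p := by
  obtain ⟨L, hL, rfl⟩ := exists_isReducedList x
  exact hL.listProd_mem_range_of_conj L g g hg h

theorem IsReducedList.exists_conj_of_sq_eq_one (L : List (Σ i, G i)) (hL : IsReducedList L)
    (hne : L ≠ []) (h : listProd L * listProd L = 1) :
    ∃ (i : ι) (g : G i) (y : CoprodI G), listProd L = y * of g * y⁻¹ := by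
  induction hn : L.length using Nat.strong_induction_on generalizing L with
  | _ n ih =>
  subst hn
  rcases L with _ | ⟨⟨j, x⟩, M⟩
  · exact absurd rfl hne
  rcases List.eq_nil_or_concat M with rfl | ⟨M, ⟨k, y⟩, rfl⟩
  · exact ⟨j, x, 1, by simp⟩
  rw [List.concat_eq_append] at *
  by_cases hk : k = j
  · subst hk
    have hM : IsReducedList M := hL.tail.left_of_append
    have hconj : ∀ z, z = of x⁻¹ * listProd (⟨k, x⟩ :: (M ++ [⟨k, y⟩])) * of x →
        (z * z = 1 ∧ ∀ (i : ι) (g : G i) (w : CoprodI G), z = w * of g * w⁻¹ →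
          ∃ (i : ι) (g : G i) (w : CoprodI G),
            listProd (⟨k, x⟩ :: (M ++ [⟨k, y⟩])) = w * of g * w⁻¹) := by
      rintro z rfl
      generalize listProd (⟨k, x⟩ :: (M ++ [⟨k, y⟩])) = u at h
      refine ⟨?_, fun i g w hw => ⟨i, g, of x * w, ?_⟩⟩
      · calc of x⁻¹ * u * of x * (of x⁻¹ * u * of x) = of x⁻¹ * (u * u) * of x := by
              rw [map_inv]; group
          _ = 1 := by rw [h, map_inv]; group
      · calc u = of x * (of x⁻¹ * u * of x) * (of x)⁻¹ := by rw [map_inv]; group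
          _ = _ := by rw [hw]; group
    by_cases hyx : y * x = 1
    · have hz := hconj (listProd M) (by
        simp only [listProd_cons, listProd_append, listProd_nil, mul_one, map_inv, mul_assoc]
        rw [← map_mul, hyx]
        simp)
      rcases eq_or_ne M [] with rfl | hM0
      · exact hz.2 k 1 1 (by simp)
      · obtain ⟨i, g, w, hw⟩ := ih M.length (by simp) M hM hM0 hz.1 rfl
        exact hz.2 i g w hw
    · have hz := hconj (listProd (M ++ [⟨k, y * x⟩])) (by
        simp only [listProd_cons, listProd_append, listProd_nil, mul_one, map_inv, map_mul]
        group)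
      have hred : IsReducedList (M ++ [⟨k, y * x⟩]) := by
        refine hM.append (isReducedList_singleton hyx) ?_
        have := (List.isChain_append.1 hL.tail.2).2.2
        simpa using this
      obtain ⟨i, g, w, hw⟩ := ih _ (by simp) _ hred (by simp) hz.1 rfl
      exact hz.2 i g w hw
  · have hred := hL.append hL (by
      rw [← List.cons_append, List.getLast?_concat]; simpa using hk)
    have := hred.eq_of_listProd_eq (M := []) ⟨by simp, List.isChain_nil⟩ (by
      rw [listProd_append, h, listProd_nil])
    simp at this

/-- In a free product, every involution is conjugate into a factor. -/
theorem exists_conj_of_sq_eq_one {x : CoprodI G} (hx : x ≠ 1) (h : x * x = 1) :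
    ∃ (i : ι) (g : G i) (y : CoprodI G), x = y * of g * y⁻¹ := by
  obtain ⟨L, hL, rfl⟩ := exists_isReducedList x
  exact hL.exists_conj_of_sq_eq_one L (by rintro rfl; simp at hx) h

end Monoid.CoprodI

section RACGHom

variable {V W : Type*} {G : SimpleGraph V} {H : SimpleGraph W} {M : Type*} [Group M]

theorem racgGen_mul_self (G : SimpleGraph V) (v : V) : racgGen G v * racgGen G v = 1 := by
  refine (QuotientGroup.eq_one_iff _).2 (Subgroup.subset_normalClosure (Or.inl ⟨v, rfl⟩))

theorem racgGen_commute {u v : V} (h : G.Adj u v) :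
    Commute (racgGen G u) (racgGen G v) := by
  have h2 : (racgGen G u * racgGen G v) ^ 2 = 1 :=
    (QuotientGroup.eq_one_iff _).2 (Subgroup.subset_normalClosure (Or.inr ⟨u, v, h, rfl⟩))
  have hu := inv_eq_of_mul_eq_one_right (racgGen_mul_self G u)
  have hv := inv_eq_of_mul_eq_one_right (racgGen_mul_self G v)
  have := eq_inv_of_mul_eq_one_left ((pow_two _).symm.trans h2)
  rwa [mul_inv_rev, hu, hv] at this

/-- The homomorphism from a right-angled Coxeter group induced by a family of elements of order
dividing two, those indexed by adjacent vertices commuting. -/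
def racgLift (f : V → M) (hf : ∀ v, f v * f v = 1)
    (hc : ∀ u v, G.Adj u v → Commute (f u) (f v)) : RACG G →* M :=
  PresentedGroup.toGroup (f := f) (by
    rintro r (⟨v, rfl⟩ | ⟨u, v, h, rfl⟩)
    · simp [hf]
    · rw [map_pow, map_mul, FreeGroup.lift_apply_of, FreeGroup.lift_apply_of, (hc u v h).mul_pow,
        pow_two, pow_two, hf, hf, one_mul])

@[simp]
theorem racgLift_gen (f : V → M) (hf : ∀ v, f v * f v = 1)
    (hc : ∀ u v, G.Adj u v → Commute (f u) (f v)) (v : V) :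
    racgLift f hf hc (racgGen G v) = f v :=
  PresentedGroup.toGroup.of _

theorem racg_hom_ext {f g : RACG G →* M} (h : ∀ v, f (racgGen G v) = g (racgGen G v)) :
    f = g :=
  PresentedGroup.ext h

theorem racg_injective_of_leftInverse (f : RACG G →* M) (g : M →* RACG G)
    (h : ∀ v, g (f (racgGen G v)) = racgGen G v) : Function.Injective f := by
  have : g.comp f = MonoidHom.id _ := racg_hom_ext h
  exact Function.LeftInverse.injective (g := g) (DFunLike.congr_fun this)

/-- An induced subgraph gives a subgroup of the right-angled Coxeter group. -/
theorem exists_injective_racg_of_embedding (e : G ↪g H) :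
    ∃ φ : RACG G →* RACG H, Function.Injective φ := by
  classical
  refine ⟨racgLift (fun v => racgGen H (e v)) (fun v => racgGen_mul_self H _)
    (fun u v h => racgGen_commute (e.map_adj_iff.2 h)), ?_⟩
  refine racg_injective_of_leftInverse _
    (racgLift (fun w => if h : ∃ v, e v = w then racgGen G h.choose else 1) ?_ ?_) ?_
  · intro w
    split_ifs
    · exact racgGen_mul_self G _
    · simp
  · intro u v huv
    by_cases hu : ∃ x, e x = u
    · by_cases hv : ∃ x, e x = v
      · simp only [hu, hv, dite_true]
        refine racgGen_commute (e.map_adj_iff.1 ?_)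
        rwa [hu.choose_spec, hv.choose_spec]
      · simp [hv]
    · simp [hu]
  · intro v
    have hv : ∃ x, e x = e v := ⟨v, rfl⟩
    simp only [racgLift_gen, hv, dite_true]
    rw [e.injective hv.choose_spec]

/-- Generators of distinct non-adjacent vertices can be sent to any two involutions, all the
other generators being killed. -/
theorem exists_racg_hom_of_not_adj [DecidableEq V] {u v : V} (huv : ¬ G.Adj u v) {s t : M}
    (hs : s * s = 1) (ht : t * t = 1) :
    ∃ f : RACG G →* M, ∀ w, f (racgGen G w) = if w = u then s else if w = v then t else 1 := by
  refine ⟨racgLift (fun w => if w = u then s else if w = v then t else 1) ?_ ?_,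
    fun w => racgLift_gen _ _ _ w⟩
  · intro w
    split_ifs <;> simp [hs, ht]
  · intro x y hxy
    split_ifs with h1 h2 h3 h4 h5 h6 <;> subst_vars <;>
      first
      | exact Commute.one_right _
      | exact Commute.one_left _
      | exact Commute.refl _
      | exact absurd hxy huv
      | exact absurd hxy.symm huv

end RACGHom

section PathGraph

theorem hasse_int_adj {i j : ℤ} :
    (SimpleGraph.hasse ℤ).Adj i j ↔ i + 1 = j ∨ j + 1 = i := by
  simp [SimpleGraph.hasse_adj, Order.covBy_iff_add_one_eq]

/-- The finite path graphs are induced subgraphs of the bi-infinite path. -/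
def pathGraphEmbeddingInt (n : ℕ) : SimpleGraph.pathGraph n ↪g SimpleGraph.hasse ℤ where
  toFun i := (i : ℕ)
  inj' i j h := by
    have h : ((i : ℕ) : ℤ) = (j : ℕ) := h
    exact Fin.ext (by exact_mod_cast h)
  map_rel_iff' {i j} := by
    change (SimpleGraph.hasse ℤ).Adj ((i : ℕ) : ℤ) ((j : ℕ) : ℤ) ↔ _
    rw [hasse_int_adj, SimpleGraph.pathGraph_adj]
    norm_cast

/-- The automorphism of the right-angled Coxeter group of the bi-infinite path induced by the
point reflection sending `i` to `m - i`. -/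
noncomputable def racgIntReflection (m : ℤ) : MulAut (RACG (SimpleGraph.hasse ℤ)) :=
  let f : RACG (SimpleGraph.hasse ℤ) →* RACG (SimpleGraph.hasse ℤ) :=
    racgLift (fun i => racgGen _ (m - i)) (fun _ => racgGen_mul_self _ _) (fun i j h => by
      refine racgGen_commute ?_
      rw [hasse_int_adj] at h ⊢
      omega)
  have hf : f.comp f = MonoidHom.id _ := racg_hom_ext fun i => by simp [f]
  MonoidHom.toMulEquiv f f hf hf

theorem racgIntReflection_gen (m i : ℤ) :
    racgIntReflection m (racgGen _ i) = racgGen _ (m - i) := by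
  simp [racgIntReflection]

theorem racgIntReflection_mul_self (m : ℤ) :
    racgIntReflection m * racgIntReflection m = 1 := by
  have : (racgIntReflection m * racgIntReflection m).toMonoidHom = MonoidHom.id _ :=
    racg_hom_ext fun i => by simp [racgIntReflection_gen]
  ext x
  exact DFunLike.congr_fun this x

theorem zpow_reflections_gen (k i : ℤ) :
    ((racgIntReflection 2 * racgIntReflection 0) ^ k) (racgGen _ i) = racgGen _ (i + 2 * k) := by
  induction k using Int.induction_on generalizing i with
  | zero => simp
  | succ k ih =>
    rw [zpow_add_one, MulAut.mul_apply, MulAut.mul_apply, racgIntReflection_gen,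
      racgIntReflection_gen, ih]
    congr 1
    ring
  | pred k ih =>
    have hinv : (racgIntReflection 2 * racgIntReflection 0)⁻¹ =
        racgIntReflection 0 * racgIntReflection 2 := by
      rw [mul_inv_rev, inv_eq_of_mul_eq_one_right (racgIntReflection_mul_self 2),
        inv_eq_of_mul_eq_one_right (racgIntReflection_mul_self 0)]
    rw [zpow_sub_one, hinv, MulAut.mul_apply, MulAut.mul_apply, racgIntReflection_gen,
      racgIntReflection_gen, ih]
    congr 1
    ring

/-- The semidirect product of the right-angled Coxeter group of the bi-infinite path with its
automorphism group. -/
abbrev RacgIntHolomorph : Type :=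
  RACG (SimpleGraph.hasse ℤ) ⋊[MonoidHom.id (MulAut (RACG (SimpleGraph.hasse ℤ)))]
    MulAut (RACG (SimpleGraph.hasse ℤ))

open SemidirectProduct in
theorem commute_inr_inl {α : MulAut (RACG (SimpleGraph.hasse ℤ))}
    {x : RACG (SimpleGraph.hasse ℤ)} (h : α x = x) :
    Commute (inr α : RacgIntHolomorph) (inl x) := by
  have := inl_aut (φ := MonoidHom.id (MulAut (RACG (SimpleGraph.hasse ℤ)))) α x
  rw [MonoidHom.id_apply, h, map_inv] at this
  exact (eq_mul_inv_iff_mul_eq.1 this).symm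

open SemidirectProduct in
/-- The right-angled Coxeter group of the path on four vertices, mapped to the holomorph: the
endpoints go to point reflections, the inner vertices to two consecutive generators. -/
noncomputable def racgPathFourToHolomorph : RACG (SimpleGraph.pathGraph 4) →* RacgIntHolomorph :=
  racgLift ![inr (racgIntReflection 0), inl (racgGen _ 0), inl (racgGen _ 1),
      inr (racgIntReflection 2)]
    (by
      intro v
      fin_cases v
      · simp [← map_mul, racgIntReflection_mul_self]
      · simp [← map_mul, racgGen_mul_self]
      · simp [← map_mul, racgGen_mul_self]
      · simp [← map_mul, racgIntReflection_mul_self])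
    (by
      have h01 : Commute (inr (racgIntReflection 0) : RacgIntHolomorph) (inl (racgGen _ 0)) :=
        commute_inr_inl (by simp [racgIntReflection_gen])
      have h12 : Commute (inl (racgGen _ 0) : RacgIntHolomorph) (inl (racgGen _ 1)) :=
        (racgGen_commute (hasse_int_adj.2 (Or.inl rfl))).map inl
      have h32 : Commute (inr (racgIntReflection 2) : RacgIntHolomorph) (inl (racgGen _ 1)) :=
        commute_inr_inl (by simp [racgIntReflection_gen])
      intro u v h
      rw [SimpleGraph.pathGraph_adj] at h
      fin_cases u <;> fin_cases v <;> simp at h <;>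
        first
        | exact h01
        | exact h01.symm
        | exact h12
        | exact h12.symm
        | exact h32.symm)

/-- The element of `C(S_3)` acting on the bi-infinite path as the translation by two. -/
def pathFourTranslation : RACG (SimpleGraph.pathGraph 4) :=
  racgGen (SimpleGraph.pathGraph 4) 3 * racgGen (SimpleGraph.pathGraph 4) 0

/-- The image in `C(S_3)` of the vertex `i` of the bi-infinite path. -/
def pathFourOfInt (i : ℤ) : RACG (SimpleGraph.pathGraph 4) :=
  pathFourTranslation ^ (i / 2) * racgGen (SimpleGraph.pathGraph 4) (if i % 2 = 0 then 1 else 2) *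
    (pathFourTranslation ^ (i / 2))⁻¹

theorem pathFourOfInt_commute_succ (i : ℤ) :
    Commute (pathFourOfInt i) (pathFourOfInt (i + 1)) := by
  have adj : ∀ u v : Fin 4, (u : ℕ) + 1 = v → Commute (racgGen (SimpleGraph.pathGraph 4) u)
      (racgGen (SimpleGraph.pathGraph 4) v) := fun u v h =>
    racgGen_commute (SimpleGraph.pathGraph_adj.2 (Or.inl h))
  have h01 := adj 0 1 rfl
  have h12 := adj 1 2 rfl
  have h23 := adj 2 3 rfl
  rcases Int.even_or_odd' i with ⟨k, rfl | rfl⟩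
  · have e1 : 2 * k / 2 = k := by omega
    have e2 : (2 * k + 1) / 2 = k := by omega
    have e3 : 2 * k % 2 = 0 := by omega
    have e4 : (2 * k + 1) % 2 ≠ 0 := by omega
    rw [pathFourOfInt, pathFourOfInt, e1, e2, if_pos e3, if_neg e4]
    exact (Commute.conj_iff _).2 h12
  · have e1 : (2 * k + 1) / 2 = k := by omega
    have e2 : (2 * k + 1 + 1) / 2 = k + 1 := by omega
    have e3 : (2 * k + 1) % 2 ≠ 0 := by omega
    have e4 : (2 * k + 1 + 1) % 2 = 0 := by omega
    rw [pathFourOfInt, pathFourOfInt, e1, e2, if_neg e3, if_pos e4]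
    have key : pathFourTranslation ^ (k + 1) * racgGen (SimpleGraph.pathGraph 4) 1 *
        (pathFourTranslation ^ (k + 1))⁻¹ =
        pathFourTranslation ^ k * (racgGen (SimpleGraph.pathGraph 4) 3 *
          racgGen (SimpleGraph.pathGraph 4) 1 * (racgGen (SimpleGraph.pathGraph 4) 3)⁻¹) *
        (pathFourTranslation ^ k)⁻¹ := by
      have : racgGen (SimpleGraph.pathGraph 4) 1 = racgGen (SimpleGraph.pathGraph 4) 0 *
          racgGen (SimpleGraph.pathGraph 4) 1 * (racgGen (SimpleGraph.pathGraph 4) 0)⁻¹ := by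
        rw [h01.eq, mul_inv_cancel_right]
      conv_rhs => rw [this]
      rw [zpow_add_one]
      nth_rewrite 2 [pathFourTranslation]
      nth_rewrite 3 [pathFourTranslation]
      group
    rw [key]
    exact (Commute.conj_iff _).2 ((h23.mul_right h12.symm).mul_right h23.inv_right)

theorem pathFourOfInt_mul_self (i : ℤ) : pathFourOfInt i * pathFourOfInt i = 1 := by
  rw [pathFourOfInt, conj_mul, racgGen_mul_self]
  group

/-- The right-angled Coxeter group of the bi-infinite path embeds in `C(S_3)`. -/
theorem exists_injective_racg_int :
    ∃ φ : RACG (SimpleGraph.hasse ℤ) →* RACG (SimpleGraph.pathGraph 4),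
      Function.Injective φ := by
  refine ⟨racgLift pathFourOfInt pathFourOfInt_mul_self fun i j h => ?_, ?_⟩
  · rcases hasse_int_adj.1 h with rfl | rfl
    · exact pathFourOfInt_commute_succ _
    · exact (pathFourOfInt_commute_succ _).symm
  · refine Function.Injective.of_comp (f := racgPathFourToHolomorph) ?_
    rw [← MonoidHom.coe_comp]
    convert SemidirectProduct.inl_injective 
      (φ := MonoidHom.id (MulAut (RACG (SimpleGraph.hasse ℤ)))) using 2
    refine racg_hom_ext fun i => ?_
    have ht : racgPathFourToHolomorph pathFourTranslation =
        SemidirectProduct.inr (racgIntReflection 2 * racgIntReflection 0) := by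
      simp [pathFourTranslation, racgPathFourToHolomorph]
    have hg : racgPathFourToHolomorph (racgGen (SimpleGraph.pathGraph 4)
        (if i % 2 = 0 then 1 else 2)) = SemidirectProduct.inl (racgGen _ (i % 2)) := by
      rcases Int.emod_two_eq_zero_or_one i with h | h <;> simp [h, racgPathFourToHolomorph]
    rw [MonoidHom.comp_apply, racgLift_gen, pathFourOfInt, map_mul, map_mul, map_inv, map_zpow,
      ht, hg, ← map_zpow, ← map_inv, ← SemidirectProduct.inl_aut, MonoidHom.id_apply,
      zpow_reflections_gen, Int.emod_add_mul_ediv]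

end PathGraph

section CompleteBipartite

variable {V : Type*} {G : SimpleGraph V}

theorem nonempty_pathGraph_four_embedding {a b c d : V} (hab : G.Adj a b) (hbc : G.Adj b c)
    (hcd : G.Adj c d) (hac : ¬ G.Adj a c) (hbd : ¬ G.Adj b d) (had : ¬ G.Adj a d) :
    Nonempty (SimpleGraph.pathGraph 4 ↪g G) := by
  have hca : ¬ G.Adj c a := fun h => hac h.symm
  have hdb : ¬ G.Adj d b := fun h => hbd h.symm
  have hda : ¬ G.Adj d a := fun h => had h.symm
  have hac' : a ≠ c := by rintro rfl; exact had hcd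
  have hbd' : b ≠ d := by rintro rfl; exact had hab
  have had' : a ≠ d := by rintro rfl; exact hac hcd.symm
  refine ⟨⟨⟨![a, b, c, d], ?_⟩, ?_⟩⟩
  · intro i j h
    fin_cases i <;> fin_cases j <;>
      simp [hab.ne, hbc.ne, hcd.ne, hab.ne', hbc.ne', hcd.ne', hac', hbd', had', hac'.symm,
        hbd'.symm, had'.symm] at h ⊢
  · intro i j
    change G.Adj (![a, b, c, d] i) (![a, b, c, d] j) ↔ _
    rw [SimpleGraph.pathGraph_adj]
    fin_cases i <;> fin_cases j <;>
      simp [hab, hbc, hcd, hab.symm, hbc.symm, hcd.symm, hac, hbd, had, hca, hdb, hda]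

theorem not_adj_of_cliqueFree_three (hG : G.CliqueFree 3) {a b c : V} (hab : G.Adj a b)
    (hac : G.Adj a c) : ¬ G.Adj b c := by
  classical
  exact fun hbc => hG {a, b, c} (SimpleGraph.is3Clique_triple_iff.2 ⟨hab, hac, hbc⟩)

/-- In a triangle-free graph without induced path on four vertices, vertices with a common
neighbour have the same neighbours. -/
theorem adj_of_common_neighbor (hG : G.CliqueFree 3)
    (hP : ¬ Nonempty (SimpleGraph.pathGraph 4 ↪g G)) {u v w x : V} (huv : G.Adj u v)
    (hvw : G.Adj v w) (hwx : G.Adj w x) : G.Adj u x := by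
  by_contra hux
  exact hP (nonempty_pathGraph_four_embedding huv hvw hwx
    (not_adj_of_cliqueFree_three hG huv.symm hvw)
    (not_adj_of_cliqueFree_three hG hvw.symm hwx) hux)

/-- A triangle-free graph without induced path on four vertices is a disjoint union of complete
bipartite graphs. -/
theorem exists_completeBipartite_decomposition (hG : G.CliqueFree 3)
    (hP : ¬ Nonempty (SimpleGraph.pathGraph 4 ↪g G)) :
    ∃ (k : V → G.ConnectedComponent) (s : V → Prop),
      ∀ u v, G.Adj u v ↔ k u = k v ∧ (s u ↔ ¬ s v) := by
  have key : ∀ r v : V, G.Reachable r v → G.Adj r v ∨ ∀ x, G.Adj v x ↔ G.Adj r x := by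
    intro r v h
    rw [SimpleGraph.reachable_iff_reflTransGen] at h
    induction h with
    | refl => exact Or.inr fun x => Iff.rfl
    | tail _ hvw ih =>
      rcases ih with hrv | hv
      · exact Or.inr fun x => ⟨adj_of_common_neighbor hG hP hrv hvw,
          adj_of_common_neighbor hG hP hvw.symm hrv.symm⟩
      · exact Or.inl ((hv _).1 hvw)
  let root : V → V := fun v => (G.connectedComponentMk v).out
  have hroot : ∀ v, G.Reachable (root v) v := fun v =>
    SimpleGraph.ConnectedComponent.exact (Quot.out_eq (G.connectedComponentMk v))
  refine ⟨G.connectedComponentMk, fun v => G.Adj (root v) v, fun u v => ?_⟩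
  constructor
  · intro h
    have huv : G.connectedComponentMk u = G.connectedComponentMk v :=
      SimpleGraph.ConnectedComponent.connectedComponentMk_eq_of_adj h
    have hr : root u = root v := congrArg Quot.out huv
    refine ⟨huv, ?_⟩
    dsimp only
    rw [hr]
    constructor
    · exact fun hu hv => not_adj_of_cliqueFree_three hG hu hv h
    · intro hv
      exact (((key _ _ (hroot v)).resolve_left hv) u).1 h.symm
  · rintro ⟨huv, hs⟩
    have hr : root u = root v := congrArg Quot.out huv
    by_cases hv : G.Adj (root v) v
    · have hu : ¬ G.Adj (root u) u := fun hu => hs.1 hu hv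
      exact (((key _ _ (hroot u)).resolve_left hu) v).2 (hr ▸ hv)
    · exact ((((key _ _ (hroot v)).resolve_left hv) u).2 (hr ▸ hs.2 hv)).symm

end CompleteBipartite

section FreeProduct

open Monoid

/-- The homomorphism from the cyclic group of order two determined by an element of order
dividing two. -/
def cyclicTwoLift {M : Type*} [Group M] (g : M) (hg : g * g = 1) :
    Multiplicative (ZMod 2) →* M where
  toFun z := if z = 1 then 1 else g
  map_one' := by simp
  map_mul' x y := by
    have h : ∀ x y : Multiplicative (ZMod 2),
        x = 1 ∨ y = 1 ∨ (x ≠ 1 ∧ y ≠ 1 ∧ x * y = 1) := by decide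
    rcases h x y with rfl | rfl | ⟨hx, hy, hxy⟩
    · simp
    · simp
    · simp [hx, hy, hxy, hg]

theorem cyclicTwoLift_generator {M : Type*} [Group M] (g : M) (hg : g * g = 1) :
    cyclicTwoLift g hg (Multiplicative.ofAdd 1) = g := by
  have : Multiplicative.ofAdd (1 : ZMod 2) ≠ 1 := by decide
  simp [cyclicTwoLift, this]

theorem Commute.cyclicTwoLift {M : Type*} [Group M] {g h : M} (hgh : Commute g h)
    (hg : g * g = 1) (hh : h * h = 1) (x y : Multiplicative (ZMod 2)) :
    Commute (cyclicTwoLift g hg x) (cyclicTwoLift h hh y) := by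
  change Commute (if x = 1 then 1 else g) (if y = 1 then 1 else h)
  split_ifs <;> simp [hgh]

theorem Monoid.CoprodI.commute_lift_lift {ι κ : Type*} {A : ι → Type*} {B : κ → Type*}
    [∀ i, Monoid (A i)] [∀ j, Monoid (B j)] {N : Type*} [Monoid N] (f : ∀ i, A i →* N)
    (g : ∀ j, B j →* N) (h : ∀ i j x y, Commute (f i x) (g j y)) (x : CoprodI A)
    (y : CoprodI B) : Commute (CoprodI.lift f x) (CoprodI.lift g y) := by
  induction x using CoprodI.induction_on with
  | one => simp
  | of i x =>
    induction y using CoprodI.induction_on with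
    | one => simp
    | of j y => simpa using h i j x y
    | mul y z hy hz => simpa using hy.mul_right hz
  | mul x z hx hz => simpa using hx.mul_left hz

/-- The free product of groups of order two indexed by a type. -/
abbrev FreeInvolutionProduct (V : Type*) : Type _ :=
  CoprodI fun _ : V => Multiplicative (ZMod 2)

/-- In a group with self-centralizing involutions, the only elements commuting with an
involution are the identity and this involution. -/
def SelfCentralizingInvolutions (M : Type*) [Group M] : Prop :=
  ∀ x y : M, x ≠ 1 → x * x = 1 → Commute x y → y = 1 ∨ y = x

theorem selfCentralizingInvolutions_freeInvolutionProduct (V : Type*) :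
    SelfCentralizingInvolutions (FreeInvolutionProduct V) := by
  intro x y hx hxx hxy
  obtain ⟨i, g, z, rfl⟩ := CoprodI.exists_conj_of_sq_eq_one hx hxx
  have hg : g ≠ 1 := by rintro rfl; simp at hx
  have hc : Commute (CoprodI.of (M := fun _ : V => Multiplicative (ZMod 2)) (i := i) g)
      (z⁻¹ * y * z) := by
    have := (Commute.conj_iff z⁻¹).2 hxy
    simpa [mul_assoc] using this
  obtain ⟨p, hp⟩ := CoprodI.exists_eq_of_of_commute
    (G := fun _ : V => Multiplicative (ZMod 2)) (i := i) hg hc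
  have hy : y = z * CoprodI.of (M := fun _ : V => Multiplicative (ZMod 2)) (i := i) p * z⁻¹ := by
    rw [← hp]
    group
  have : ∀ g p : Multiplicative (ZMod 2), g ≠ 1 → p = 1 ∨ p = g := by decide
  rcases this g p hg with rfl | rfl
  · exact Or.inl (by simp [hy])
  · exact Or.inr hy

variable {V : Type*} {G : SimpleGraph V} {K : Type*}

/-- The right-angled Coxeter group of a disjoint union of complete bipartite graphs embeds in a
free product of squares of free products of groups of order two. -/
theorem exists_injective_racg_coprodI (k : V → K) (s : V → Prop)
    (hks : ∀ u v, G.Adj u v ↔ k u = k v ∧ (s u ↔ ¬ s v)) :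
    ∃ f : RACG G →*
      CoprodI (fun _ : K => FreeInvolutionProduct V × FreeInvolutionProduct V),
      Function.Injective f := by
  classical
  let ε : V → FreeInvolutionProduct V := fun v =>
    CoprodI.of (i := v) (Multiplicative.ofAdd (1 : ZMod 2))
  have hε : ∀ v, ε v * ε v = 1 := fun v => by
    simp only [ε, ← map_mul]
    exact map_one _
  let e : V → FreeInvolutionProduct V × FreeInvolutionProduct V := fun v =>
    if s v then (ε v, 1) else (1, ε v)
  have he : ∀ v, e v * e v = 1 := fun v => by
    by_cases hv : s v <;> simp [e, hv, hε]
  have hcomm : ∀ u v, (s u ↔ ¬ s v) → Commute (e u) (e v) := fun u v h => by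
    by_cases hv : s v
    · have hu : ¬ s u := fun hu => h.1 hu hv
      simp [e, hu, hv, Commute, SemiconjBy]
    · have hu : s u := h.2 hv
      simp [e, hu, hv, Commute, SemiconjBy]
  let restrict (p : V → Prop) : FreeInvolutionProduct V →* RACG G :=
    CoprodI.lift fun v => cyclicTwoLift (if p v then racgGen G v else 1)
      (by split_ifs <;> simp [racgGen_mul_self])
  have restrict_gen : ∀ p v, restrict p (ε v) = if p v then racgGen G v else 1 := fun p v => by
    simp only [restrict, ε, CoprodI.lift_of, cyclicTwoLift_generator]
  have restrict_comm : ∀ p q : V → Prop, (∀ u v, p u → q v → G.Adj u v) →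
      ∀ x y, Commute (restrict p x) (restrict q y) := by
    intro p q hpq
    refine CoprodI.commute_lift_lift _ _ fun u v => Commute.cyclicTwoLift ?_ _ _
    split_ifs with hu hv
    · exact racgGen_commute (hpq u v hu hv)
    all_goals simp
  let back : CoprodI (fun _ : K => FreeInvolutionProduct V × FreeInvolutionProduct V) →*
      RACG G :=
    CoprodI.lift fun i => MonoidHom.noncommCoprod
      (restrict fun v => k v = i ∧ s v) (restrict fun v => k v = i ∧ ¬ s v)
      (restrict_comm _ _ fun u v hu hv =>
        (hks u v).2 ⟨hu.1.trans hv.1.symm, by simp [hu.2, hv.2]⟩)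
  refine ⟨racgLift (fun v => CoprodI.of
      (M := fun _ : K => FreeInvolutionProduct V × FreeInvolutionProduct V) (i := k v) (e v))
     (fun v => ?_) (fun u v h => ?_), ?_⟩
  · rw [← map_mul, he, map_one]
  · obtain ⟨h1, h2⟩ := (hks u v).1 h
    rw [h1]
    exact (hcomm u v h2).map _
  · refine racg_injective_of_leftInverse _ back fun v => ?_
    rw [racgLift_gen]
    simp only [back, CoprodI.lift_of]
    by_cases hv : s v
    · simp [e, hv, MonoidHom.noncommCoprod_apply, restrict_gen]
    · simp [e, hv, MonoidHom.noncommCoprod_apply, restrict_gen]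

end FreeProduct

section NotInjective

open Monoid

theorem SelfCentralizingInvolutions.commute {M : Type*} [Group M]
    (hM : SelfCentralizingInvolutions M) {x y z : M} (hx : x ≠ 1) (hxx : x * x = 1)
    (hy : Commute x y) (hz : Commute x z) : Commute y z := by
  rcases hM x y hx hxx hy with rfl | rfl
  · exact Commute.one_left z
  · exact hz

theorem SelfCentralizingInvolutions.exists_mul_pow_eq_one {M : Type*} [Group M]
    (hM : SelfCentralizingInvolutions M) {x y : M} (hx : x ≠ 1) (hxx : x * x = 1)
    (hy : Commute x y) : ∃ n : ℕ, y * x ^ n = 1 := by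
  rcases hM x y hx hxx hy with rfl | rfl
  · exact ⟨0, by simp⟩
  · exact ⟨1, by simpa using hxx⟩

/-- In a product of two groups with self-centralizing involutions, elements `a, b, c, d`, each
commuting with the next one, satisfy a commutation relation that does not follow from these. -/
theorem SelfCentralizingInvolutions.extra_commutation {M N : Type*} [Group M] [Group N]
    (hM : SelfCentralizingInvolutions M) (hN : SelfCentralizingInvolutions N) {a b c d : M × N}
    (hb : b ≠ 1) (hc : c ≠ 1) (hbb : b * b = 1) (hcc : c * c = 1) (hne : b ≠ c)
    (hab : Commute a b) (hbc : Commute b c) (hcd : Commute c d) :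
    Commute a c ∨ Commute b d ∨ ∃ m n : ℕ, Commute (a * b ^ m) (d * c ^ n) := by
  obtain ⟨a₁, a₂⟩ := a
  obtain ⟨b₁, b₂⟩ := b
  obtain ⟨c₁, c₂⟩ := c
  obtain ⟨d₁, d₂⟩ := d
  simp only [Prod.commute_iff, Prod.mk_mul_mk, Prod.mk_eq_one, Prod.pow_mk, Prod.mk.injEq,
    ne_eq] at *
  by_cases hb₁ : b₁ = 1
  · subst hb₁
    have hb₂ : b₂ ≠ 1 := fun h => hb ⟨rfl, h⟩
    by_cases hc₁ : c₁ = 1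
    · subst hc₁
      have hc₂ : c₂ ≠ 1 := fun h => hc ⟨rfl, h⟩
      rcases hN b₂ c₂ hb₂ hbb.2 hbc.2 with h | h
      · exact absurd h hc₂
      · exact absurd ⟨rfl, h.symm⟩ hne
    by_cases hc₂ : c₂ = 1
    · subst hc₂
      obtain ⟨m, hm⟩ := hN.exists_mul_pow_eq_one hb₂ hbb.2 hab.2.symm
      obtain ⟨n, hn⟩ := hM.exists_mul_pow_eq_one hc₁ hcc.1 hcd.1
      exact Or.inr (Or.inr ⟨m, n, by simp [hn], by simp [hm]⟩)
    · exact Or.inr (Or.inl ⟨hM.commute hc₁ hcc.1 hbc.1.symm hcd.1,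
        hN.commute hc₂ hcc.2 hbc.2.symm hcd.2⟩)
  by_cases hb₂ : b₂ = 1
  · subst hb₂
    by_cases hc₂ : c₂ = 1
    · subst hc₂
      have hc₁ : c₁ ≠ 1 := fun h => hc ⟨h, rfl⟩
      rcases hM b₁ c₁ hb₁ hbb.1 hbc.1 with h | h
      · exact absurd h hc₁
      · exact absurd ⟨h.symm, rfl⟩ hne
    by_cases hc₁ : c₁ = 1
    · subst hc₁
      obtain ⟨m, hm⟩ := hM.exists_mul_pow_eq_one hb₁ hbb.1 hab.1.symm
      obtain ⟨n, hn⟩ := hN.exists_mul_pow_eq_one hc₂ hcc.2 hcd.2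
      exact Or.inr (Or.inr ⟨m, n, by simp [hm], by simp [hn]⟩)
    · exact Or.inr (Or.inl ⟨hM.commute hc₁ hcc.1 hbc.1.symm hcd.1,
        hN.commute hc₂ hcc.2 hbc.2.symm hcd.2⟩)
  · exact Or.inl ⟨hM.commute hb₁ hbb.1 hab.1.symm hbc.1,
      hN.commute hb₂ hbb.2 hab.2.symm hbc.2⟩

theorem exists_racg_hom_not_commute {V : Type*} {G : SimpleGraph V} {u v : V} (hne : u ≠ v)
    (huv : ¬ G.Adj u v) :
    ∃ f : RACG G →* Equiv.Perm (Fin 3), ¬ Commute (f (racgGen G u)) (f (racgGen G v)) ∧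
      ∀ w, w ≠ u → w ≠ v → f (racgGen G w) = 1 := by
  classical
  obtain ⟨f, hf⟩ := exists_racg_hom_of_not_adj huv (Equiv.swap_mul_self (0 : Fin 3) 1)
    (Equiv.swap_mul_self (1 : Fin 3) 2)
  refine ⟨f, ?_, fun w hu hv => by rw [hf, if_neg hu, if_neg hv]⟩
  rw [hf, hf, if_pos rfl, if_neg hne.symm, if_pos rfl]
  intro h
  exact absurd h.eq (by decide)

theorem racgGen_not_commute {V : Type*} {G : SimpleGraph V} {u v : V} (hne : u ≠ v)
    (huv : ¬ G.Adj u v) : ¬ Commute (racgGen G u) (racgGen G v) := by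
  obtain ⟨f, hf, -⟩ := exists_racg_hom_not_commute hne huv
  exact fun h => hf (h.map f)

/-- The group `C(S_3)` does not embed in a free product of direct products of pairs of groups
with self-centralizing involutions. -/
theorem not_injective_racg_pathGraph_four {K : Type*} {M N : K → Type*} [∀ i, Group (M i)]
    [∀ i, Group (N i)] (hM : ∀ i, SelfCentralizingInvolutions (M i))
    (hN : ∀ i, SelfCentralizingInvolutions (N i))
    (φ : RACG (SimpleGraph.pathGraph 4) →* CoprodI fun i => M i × N i) :
    ¬ Function.Injective φ := by
  intro hφ
  set x : Fin 4 → RACG (SimpleGraph.pathGraph 4) := racgGen _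
  have hxx : ∀ i, x i * x i = 1 := racgGen_mul_self _
  have adj : ∀ i j : Fin 4, (i : ℕ) + 1 = j → Commute (x i) (x j) := fun i j h =>
    racgGen_commute (SimpleGraph.pathGraph_adj.2 (Or.inl h))
  have h01 := adj 0 1 rfl
  have h12 := adj 1 2 rfl
  have h23 := adj 2 3 rfl
  have h02 : ¬ Commute (x 0) (x 2) :=
    racgGen_not_commute (by decide) (by simp [SimpleGraph.pathGraph_adj])
  have h13 : ¬ Commute (x 1) (x 3) :=
    racgGen_not_commute (by decide) (by simp [SimpleGraph.pathGraph_adj])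
  have hx1 : x 1 ≠ 1 := fun h => h13 (h ▸ Commute.one_left _)
  have hx2 : x 2 ≠ 1 := fun h => h02 (h ▸ Commute.one_right _)
  have hx12 : x 1 ≠ x 2 := fun h => h02 (h ▸ h01)
  have hne1 {ψ : RACG (SimpleGraph.pathGraph 4) →* CoprodI fun i => M i × N i}
      (hψ : Function.Injective ψ) {y} (hy : y ≠ 1) : ψ y ≠ 1 :=
    fun h => hy (hψ (h.trans (map_one ψ).symm))
  obtain ⟨i, b, z, hb⟩ := CoprodI.exists_conj_of_sq_eq_one (hne1 hφ hx1)
    (by rw [← map_mul, hxx, map_one])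
  obtain ⟨ψ, hψ, hψb⟩ : ∃ ψ : RACG (SimpleGraph.pathGraph 4) →* CoprodI fun i => M i × N i,
      Function.Injective ψ ∧ ψ (x 1) = CoprodI.of (M := fun i => M i × N i) b := by
    refine ⟨(MulAut.conj z⁻¹).toMonoidHom.comp φ, (MulAut.conj z⁻¹).injective.comp hφ, ?_⟩
    change z⁻¹ * φ (x 1) * z⁻¹⁻¹ = _
    rw [hb]
    group
  have hof := CoprodI.of_injective (M := fun i => M i × N i) i
  have hof_ne {j} {g : M i × N i} (hj : x j ≠ 1)
      (hg : ψ (x j) = CoprodI.of (M := fun i => M i × N i) g) : g ≠ 1 := by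
    rintro rfl
    exact hne1 hψ hj (hg.trans (map_one _))
  have hof_sq {j} {g : M i × N i} (hg : ψ (x j) = CoprodI.of (M := fun i => M i × N i) g) :
      g * g = 1 :=
    hof (by rw [map_mul, ← hg, ← map_mul, hxx, map_one, map_one])
  have hof_comm {y y'} {g g' : M i × N i} (hg : ψ y = CoprodI.of (M := fun i => M i × N i) g)
      (hg' : ψ y' = CoprodI.of (M := fun i => M i × N i) g') : Commute g g' ↔ Commute y y' := by
    rw [← commute_map_iff hof, ← hg, ← hg', commute_map_iff hψ]
  have hb1 := hof_ne hx1 hψb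
  obtain ⟨a, ha⟩ := CoprodI.exists_eq_of_of_commute hb1 (hψb ▸ h01.symm.map ψ)
  obtain ⟨c, hc⟩ := CoprodI.exists_eq_of_of_commute hb1 (hψb ▸ h12.map ψ)
  have hc1 := hof_ne hx2 hc
  obtain ⟨d, hd⟩ := CoprodI.exists_eq_of_of_commute hc1 (hc ▸ h23.map ψ)
  have hbc : b ≠ c := by
    rintro rfl
    exact hx12 (hψ (hψb.trans hc.symm))
  rcases (hM i).extra_commutation (hN i) hb1 hc1 (hof_sq hψb) (hof_sq hc) hbc
    ((hof_comm ha hψb).2 h01) ((hof_comm hψb hc).2 h12) ((hof_comm hc hd).2 h23) with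
    h | h | ⟨m, n, h⟩
  · exact h02 ((hof_comm ha hc).1 h)
  · exact h13 ((hof_comm hψb hd).1 h)
  · have h' : Commute (x 0 * x 1 ^ m) (x 3 * x 2 ^ n) :=
      (hof_comm (by simp [ha, hψb]) (by simp [hc, hd])).1 h
    obtain ⟨f, hf, hf1⟩ := exists_racg_hom_not_commute (G := SimpleGraph.pathGraph 4)
      (u := 0) (v := 3) (by decide) (by simp [SimpleGraph.pathGraph_adj])
    refine hf ?_
    have := h'.map f
    rwa [map_mul, map_mul, map_pow, map_pow, hf1 1 (by decide) (by decide),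
      hf1 2 (by decide) (by decide), one_pow, one_pow, mul_one, mul_one] at this

end NotInjective

theorem racg_segment_embedding_characterisation {V : Type*} [Fintype V]
    (Γ : SimpleGraph V) (hΓ : Γ.CliqueFree 3) :
    (Nonempty (SimpleGraph.Embedding (SimpleGraph.pathGraph 4) Γ) ↔
      ∃ φ : RACG (SimpleGraph.pathGraph 4) →* RACG Γ, Function.Injective φ) ∧
    ((∃ φ : RACG (SimpleGraph.pathGraph 4) →* RACG Γ, Function.Injective φ) ↔
      ∀ n : ℕ, ∃ φ : RACG (SimpleGraph.pathGraph (n + 1)) →* RACG Γ,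
        Function.Injective φ) := by
  refine ⟨⟨fun ⟨e⟩ => exists_injective_racg_of_embedding e, ?_⟩, ?_, fun h => h 3⟩
  · rintro ⟨φ, hφ⟩
    by_contra hP
    obtain ⟨k, s, hks⟩ := exists_completeBipartite_decomposition hΓ hP
    obtain ⟨f, hf⟩ := exists_injective_racg_coprodI k s hks
    have hW := selfCentralizingInvolutions_freeInvolutionProduct V
    exact not_injective_racg_pathGraph_four (fun _ => hW) (fun _ => hW) (f.comp φ) (hf.comp hφ)
  · rintro ⟨φ, hφ⟩ n
    obtain ⟨ι, hι⟩ := exists_injective_racg_int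
    obtain ⟨j, hj⟩ := exists_injective_racg_of_embedding (pathGraphEmbeddingInt (n + 1))
    exact ⟨φ.comp (ι.comp j), hφ.comp (hι.comp hj)⟩
end

section
/- Let Φ and Ψ be finite simple graphs with Ψ triangle-free and with Φ having no isolated vertex (every vertex of Φ has degree at least 1), and let ρ : C(Φ) → C(Ψ) be an injective group homomorphism. Then there exists a group automorphism α of C(Φ) such that the elements t_v := (ρ ∘ α)(s_v), where s_v is the canonical generator of C(Φ) corresponding to the vertex v, are pairwise distinct reflections of C(Ψ) forming a peripheral family: for all distinct vertices v, w of Φ, t_v does not separate the identity from the wall of t_w. -/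
/-- A reflection `t` separates the identity from the wall of a reflection `t'` if
`ℓ(t·x) < ℓ(x)` for every `x` such that `x⁻¹·t'·x` is a canonical generator (such `x` are
the vertices of the carrier of the wall of `t'` in the Cayley graph). -/
def SeparatesFromWall {V : Type*} (Ψ : SimpleGraph V) (t t' : RACG Ψ) : Prop :=
  ∀ x : RACG Ψ, (∃ v : V, x⁻¹ * t' * x = racgGen Ψ v) →
    racgLen Ψ (t * x) < racgLen Ψ x

namespace RACG

open Classical in
/-- `1` if the two arguments agree and `0` otherwise. -/
noncomputable def eqInd {α : Type*} (a b : α) : ZMod 2 := if a = b then 1 else 0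

theorem eqInd_self {α : Type*} (a : α) : eqInd a a = 1 := if_pos rfl

theorem eqInd_of_ne {α : Type*} {a b : α} (h : a ≠ b) : eqInd a b = 0 := if_neg h

theorem eqInd_congr {α β : Type*} {a b : α} {c d : β} (h : a = b ↔ c = d) :
    eqInd a b = eqInd c d := by
  unfold eqInd
  by_cases hab : a = b
  · rw [if_pos hab, if_pos (h.1 hab)]
  · rw [if_neg hab, if_neg fun hcd => hab (h.2 hcd)]

theorem exists_min_nat {α : Type*} {p : α → Prop} (f : α → ℕ) (h : ∃ a, p a) :
    ∃ a, p a ∧ ∀ b, p b → f a ≤ f b := by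
  obtain ⟨a, ha, hmin⟩ := (InvImage.wf f wellFounded_lt).has_min {a | p a} h
  exact ⟨a, ha, fun b hb => not_lt.1 (hmin b hb)⟩

theorem zmod_two_eq_zero_or_one (a : ZMod 2) : a = 0 ∨ a = 1 := by
  revert a; decide

theorem zmod_two_ne_one {a : ZMod 2} : a ≠ 1 ↔ a = 0 := by
  revert a; decide

theorem zmod_two_add_self (a : ZMod 2) : a + a = 0 := by
  revert a; decide

section Basic

variable {V : Type*} (G : SimpleGraph V)

theorem gen_mul_self (v : V) : racgGen G v * racgGen G v = 1 :=
  PresentedGroup.one_of_mem (rels := racgRels G) (Or.inl ⟨v, rfl⟩)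

theorem gen_inv (v : V) : (racgGen G v)⁻¹ = racgGen G v :=
  inv_eq_of_mul_eq_one_left (gen_mul_self G v)

theorem gen_mul_cancel_left (v : V) (x : RACG G) : racgGen G v * (racgGen G v * x) = x := by
  rw [← mul_assoc, gen_mul_self, one_mul]

theorem gen_commute {u v : V} (h : G.Adj u v) : Commute (racgGen G u) (racgGen G v) := by
  have h1 : (racgGen G u * racgGen G v) ^ 2 = 1 :=
    PresentedGroup.one_of_mem (rels := racgRels G) (Or.inr ⟨u, v, h, rfl⟩)
  rw [pow_two] at h1
  have h2 := eq_inv_of_mul_eq_one_left h1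
  rwa [mul_inv_rev, gen_inv, gen_inv] at h2

/-- The universal property of a right-angled Coxeter group. -/
theorem exists_lift {H : Type*} [Group H] (f : V → H) (hsq : ∀ v, f v * f v = 1)
    (hcomm : ∀ u v, G.Adj u v → Commute (f u) (f v)) :
    ∃ φ : RACG G →* H, ∀ v, φ (racgGen G v) = f v := by
  have h : ∀ r ∈ racgRels G, FreeGroup.lift f r = 1 := by
    rintro r (⟨v, rfl⟩ | ⟨u, v, huv, rfl⟩)
    · simp [hsq]
    · have := hcomm u v huv
      simp only [map_pow, map_mul, FreeGroup.lift_apply_of]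
      rw [this.mul_pow, pow_two, pow_two, hsq, hsq, one_mul]
  exact ⟨PresentedGroup.toGroup h, fun v => PresentedGroup.toGroup.of h⟩

theorem hom_ext {H : Type*} [Group H] {φ ψ : RACG G →* H}
    (h : ∀ v, φ (racgGen G v) = ψ (racgGen G v)) : φ = ψ :=
  PresentedGroup.ext h

theorem exists_word (x : RACG G) : ∃ l : List V, (l.map (racgGen G)).prod = x := by
  induction x using PresentedGroup.induction_on with | _ z =>
  induction z using FreeGroup.induction_on with
  | C1 => exact ⟨[], by simp⟩
  | of v => exact ⟨[v], by simp [racgGen, PresentedGroup.of]⟩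
  | inv_of v h =>
    obtain ⟨l, hl⟩ := h
    refine ⟨[v], ?_⟩
    rw [map_inv, List.map_singleton, List.prod_singleton]
    exact (gen_inv G v).symm
  | mul x y hx hy =>
    obtain ⟨l, hl⟩ := hx
    obtain ⟨m, hm⟩ := hy
    exact ⟨l ++ m, by simp [hl, hm]⟩

theorem gen_induction {p : RACG G → Prop} (one : p 1)
    (mul : ∀ v x, p x → p (racgGen G v * x)) (x : RACG G) : p x := by
  obtain ⟨l, rfl⟩ := exists_word G x
  induction l with
  | nil => simpa
  | cons v l ih => simpa using mul v _ ih

theorem len_prod_le (l : List V) : racgLen G (l.map (racgGen G)).prod ≤ l.length :=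
  Nat.sInf_le ⟨l, rfl, rfl⟩

theorem exists_reduced_word (x : RACG G) :
    ∃ l : List V, l.length = racgLen G x ∧ (l.map (racgGen G)).prod = x := by
  obtain ⟨l, hl⟩ := exists_word G x
  exact Nat.sInf_mem (s := {n | ∃ l : List V, l.length = n ∧ (l.map (racgGen G)).prod = x})
    ⟨_, l, rfl, hl⟩

theorem len_inv_le (x : RACG G) : racgLen G x⁻¹ ≤ racgLen G x := by
  obtain ⟨l, hl, rfl⟩ := exists_reduced_word G x
  rw [← hl]
  have : ((l.map (racgGen G)).prod)⁻¹ = (l.reverse.map (racgGen G)).prod := by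
    rw [List.prod_inv_reverse, List.map_map, List.map_reverse]
    congr 3
    ext v
    simp [gen_inv]
  rw [this]
  simpa using len_prod_le G l.reverse

theorem len_inv (x : RACG G) : racgLen G x⁻¹ = racgLen G x :=
  le_antisymm (len_inv_le G x) (by simpa using len_inv_le G x⁻¹)

theorem gen_eq_of_conj {p : RACG G} {b c : V} (h : p * racgGen G c = racgGen G b * p) :
    b = c := by
  by_contra hne
  obtain ⟨φ, hφ⟩ := exists_lift G (fun w => Multiplicative.ofAdd (eqInd w b))
    (fun w => by rw [← ofAdd_add, zmod_two_add_self]; rfl) (fun _ _ _ => Commute.all _ _)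
  have h' := congrArg φ h
  rw [map_mul, map_mul, mul_comm, mul_right_cancel_iff, hφ, hφ, eqInd_self,
    eqInd_of_ne (Ne.symm hne)] at h'
  exact absurd (Multiplicative.ofAdd.injective h') (by decide)

theorem gen_injective : Function.Injective (racgGen G) := fun u v h =>
  gen_eq_of_conj G (p := 1) (by rw [one_mul, mul_one, h])

/-- The parity homomorphism, sending each canonical generator to `1`. -/
theorem exists_parity : ∃ φ : RACG G →* Multiplicative (ZMod 2),
    ∀ v, φ (racgGen G v) = Multiplicative.ofAdd 1 :=
  exists_lift G (fun _ => Multiplicative.ofAdd 1) (fun _ => by decide)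
    (fun _ _ _ => Commute.all _ _)

theorem gen_ne_one (v : V) : racgGen G v ≠ 1 := by
  obtain ⟨φ, hφ⟩ := exists_parity G
  intro h
  have h' := congrArg φ h
  rw [hφ, map_one φ] at h'
  exact absurd h' (by decide)

theorem gen_mul_gen_not_isReflection (u v : V) :
    ¬ IsReflection G (racgGen G u * racgGen G v) := by
  rintro ⟨g, w, h⟩
  obtain ⟨φ, hφ⟩ := exists_parity G
  have h' := congrArg φ h
  rw [map_mul, map_mul, map_mul, map_inv, mul_right_comm, mul_inv_cancel, hφ, hφ, hφ] at h'
  exact absurd h' (by decide)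

theorem isReflection_gen (v : V) : IsReflection G (racgGen G v) := ⟨1, v, by simp⟩

variable {G} in
theorem _root_.IsReflection.conj {t : RACG G} (h : IsReflection G t) (g : RACG G) :
    IsReflection G (g * t * g⁻¹) := by
  obtain ⟨x, v, rfl⟩ := h
  exact ⟨g * x, v, by group⟩

variable {G} in
theorem _root_.IsReflection.mul_self {t : RACG G} (h : IsReflection G t) : t * t = 1 := by
  obtain ⟨x, v, rfl⟩ := h
  rw [show x * racgGen G v * x⁻¹ * (x * racgGen G v * x⁻¹)
    = x * (racgGen G v * racgGen G v) * x⁻¹ by group, gen_mul_self]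
  group

/-- The permutation of `W × ZMod 2` by which a generator acts in the reflection cocycle. -/
noncomputable def reflPerm (v : V) : Equiv.Perm (RACG G × ZMod 2) :=
  Function.Involutive.toPerm
    (fun p => (racgGen G v * p.1 * racgGen G v, p.2 + eqInd p.1 (racgGen G v))) (by
      rintro ⟨t, e⟩
      have h : eqInd (racgGen G v * t * racgGen G v) (racgGen G v) = eqInd t (racgGen G v) := by
        refine eqInd_congr ⟨fun h => ?_, fun h => by rw [h, gen_mul_self, one_mul]⟩
        rw [mul_eq_right, mul_eq_one_iff_inv_eq, gen_inv] at h
        exact h.symm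
      ext
      · simp [mul_assoc, gen_mul_self, gen_mul_cancel_left]
      · simp only [h]
        rw [add_assoc, zmod_two_add_self, add_zero])

theorem reflPerm_apply (v : V) (p : RACG G × ZMod 2) : reflPerm G v p =
    (racgGen G v * p.1 * racgGen G v, p.2 + eqInd p.1 (racgGen G v)) := rfl

theorem reflPerm_commute {u v : V} (h : G.Adj u v) :
    Commute (reflPerm G u) (reflPerm G v) := by
  have key : ∀ {u v : V} (_ : G.Adj u v) (t : RACG G),
      eqInd (racgGen G u * t * racgGen G u) (racgGen G v) = eqInd t (racgGen G v) := by
    intro u v h t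
    have hc := gen_commute G h
    refine eqInd_congr ⟨fun h => ?_, fun h => ?_⟩
    · calc t = racgGen G u * (racgGen G u * t * racgGen G u) * racgGen G u := by
            simp [mul_assoc, gen_mul_self, gen_mul_cancel_left]
        _ = racgGen G v := by rw [h, hc.eq, mul_assoc, gen_mul_self, mul_one]
    · rw [h, hc.eq, mul_assoc, gen_mul_self, mul_one]
  have hc := gen_commute G h
  ext ⟨t, e⟩
  · simp only [Equiv.Perm.coe_mul, Function.comp_apply, reflPerm_apply]
    rw [show racgGen G u * (racgGen G v * t * racgGen G v) * racgGen G u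
      = (racgGen G u * racgGen G v) * t * (racgGen G v * racgGen G u) by group, hc.eq, ← hc.eq]
    simp only [mul_assoc, hc.eq]
  · simp only [Equiv.Perm.coe_mul, Function.comp_apply, reflPerm_apply]
    rw [key h, key h.symm, add_right_comm]

/-- The action of the group on `W × ZMod 2` underlying the reflection cocycle. -/
theorem exists_reflAction : ∃ φ : RACG G →* Equiv.Perm (RACG G × ZMod 2),
    ∀ v, φ (racgGen G v) = reflPerm G v :=
  exists_lift G (reflPerm G)
    (fun _ => Equiv.ext fun p => Function.Involutive.toPerm_involutive _ p)
    (fun _ _ => reflPerm_commute G)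

/-- The reflection cocycle: for a reflection `t` it is `1` exactly if the wall of `t` separates
the identity from `x`. -/
noncomputable def side (x t : RACG G) : ZMod 2 :=
  ((exists_reflAction G).choose x⁻¹ (t, 0)).2

theorem reflAction_apply (x t : RACG G) (e : ZMod 2) :
    (exists_reflAction G).choose x (t, e) = (x * t * x⁻¹, e + side G x⁻¹ t) := by
  have hφ := (exists_reflAction G).choose_spec
  unfold side
  rw [inv_inv]
  set φ := (exists_reflAction G).choose
  induction x using gen_induction generalizing e with
  | one => simp
  | mul v x ih =>
    rw [map_mul, Equiv.Perm.mul_apply, Equiv.Perm.mul_apply, ih e, ih 0, hφ, reflPerm_apply,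
      reflPerm_apply]
    ext
    · simp [mul_assoc, gen_inv]
    · simp [add_assoc]

theorem side_mul (x y t : RACG G) : side G (x * y) t = side G x t + side G y (x⁻¹ * t * x) := by
  have h := reflAction_apply G (y⁻¹ * x⁻¹) t 0
  rw [map_mul, Equiv.Perm.mul_apply, reflAction_apply, reflAction_apply] at h
  simpa using (congrArg Prod.snd h).symm

theorem side_one (t : RACG G) : side G 1 t = 0 := by
  simp [side]

theorem side_gen (v : V) (t : RACG G) : side G (racgGen G v) t = eqInd t (racgGen G v) := by
  unfold side
  rw [gen_inv, (exists_reflAction G).choose_spec, reflPerm_apply, zero_add]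

theorem side_gen_mul (v : V) (x t : RACG G) : side G (racgGen G v * x) t =
    eqInd t (racgGen G v) + side G x (racgGen G v * t * racgGen G v) := by
  rw [side_mul, side_gen, gen_inv]

theorem side_gen_mul_gen (v : V) (x : RACG G) : side G (racgGen G v * x) (racgGen G v) =
    1 + side G x (racgGen G v) := by
  rw [side_gen_mul, eqInd_self, gen_mul_self, one_mul]

variable {G}

theorem conj_gen_eq {u : V} {t : RACG G} (h : Commute (racgGen G u) t) :
    racgGen G u * t * racgGen G u = t := by
  rw [h.eq, mul_assoc, gen_mul_self, mul_one]

theorem side_gen_mul_of_adj {u v : V} (h : G.Adj u v) (x : RACG G) :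
    side G (racgGen G u * x) (racgGen G v) = side G x (racgGen G v) := by
  rw [side_gen_mul, eqInd_of_ne fun h' => h.ne (gen_injective G h').symm, zero_add,
    conj_gen_eq (gen_commute G h)]

theorem side_self {t : RACG G} (ht : IsReflection G t) : side G t t = 1 := by
  obtain ⟨g, v, rfl⟩ := ht
  have h := side_mul G g g⁻¹ (g * racgGen G v * g⁻¹)
  rw [mul_inv_cancel, side_one] at h
  rw [side_mul, side_mul]
  simp only [side_gen]
  rw [show g⁻¹ * (g * racgGen G v * g⁻¹) * g = racgGen G v by group] at h ⊢
  rw [show (g * racgGen G v)⁻¹ * (g * racgGen G v * g⁻¹) * (g * racgGen G v) = racgGen G v by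
    group, eqInd_self, add_right_comm, ← h, zero_add]

theorem len_mul_lt_of_side {x t : RACG G} (h : side G x t = 1) :
    racgLen G (t * x) < racgLen G x := by
  have key : ∀ (l : List V) (t : RACG G), side G (l.map (racgGen G)).prod t = 1 →
      ∃ m : List V, m.length < l.length ∧
        t * (l.map (racgGen G)).prod = (m.map (racgGen G)).prod := by
    intro l
    induction l with
    | nil => intro t h; simp [side_one] at h
    | cons v l ih =>
      intro t h
      rw [List.map_cons, List.prod_cons, side_gen_mul] at h
      by_cases ht : t = racgGen G v
      · exact ⟨l, by simp, by simp [ht, gen_mul_cancel_left]⟩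
      · rw [eqInd_of_ne ht, zero_add] at h
        obtain ⟨m, hm, hp⟩ := ih _ h
        refine ⟨v :: m, by simpa using hm, ?_⟩
        rw [List.map_cons, List.prod_cons, List.map_cons, List.prod_cons, ← hp]
        simp only [mul_assoc, gen_mul_cancel_left]
  obtain ⟨l, hl, rfl⟩ := exists_reduced_word G x
  obtain ⟨m, hm, hp⟩ := key l t h
  rw [hp, ← hl]
  exact (len_prod_le G m).trans_lt hm

theorem side_eq_one_iff {x t : RACG G} (ht : IsReflection G t) :
    side G x t = 1 ↔ racgLen G (t * x) < racgLen G x := by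
  refine ⟨len_mul_lt_of_side, fun h => ?_⟩
  by_contra hne
  rw [← ne_eq, zmod_two_ne_one] at hne
  have h1 : side G (t * x) t = 1 := by
    rw [side_mul, side_self ht, inv_mul_cancel, one_mul, hne, add_zero]
  have := len_mul_lt_of_side h1
  rw [← mul_assoc, ht.mul_self, one_mul] at this
  omega

/-- Every nontrivial element has a left descent. -/
theorem exists_descent {x : RACG G} (hx : x ≠ 1) : ∃ s, side G x (racgGen G s) = 1 := by
  obtain ⟨l, hl, rfl⟩ := exists_reduced_word G x
  cases l with
  | nil => simp at hx
  | cons s l =>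
    refine ⟨s, (side_eq_one_iff (isReflection_gen G s)).2 ?_⟩
    rw [← hl, List.map_cons, List.prod_cons, gen_mul_cancel_left]
    exact (len_prod_le G l).trans_lt (by simp)

/-- The reflections of the dihedral subgroup generated by two canonical generators. -/
def dihedralRefl (b s : RACG G) (i : ℤ) : RACG G := (b * s) ^ (-i) * b

theorem gen_mul_gen_inv (b s : V) :
    (racgGen G b * racgGen G s)⁻¹ = racgGen G s * racgGen G b := by
  rw [mul_inv_rev, gen_inv, gen_inv]

theorem conj_dihedralRefl_left (b s : V) (i : ℤ) :
    racgGen G b * dihedralRefl (racgGen G b) (racgGen G s) i * racgGen G b =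
      dihedralRefl (racgGen G b) (racgGen G s) (-i) := by
  have h := conj_zpow (i := -i) (a := racgGen G b) (b := racgGen G b * racgGen G s)
  rw [gen_mul_cancel_left, gen_inv, ← gen_mul_gen_inv, inv_zpow, ← zpow_neg] at h
  unfold dihedralRefl
  rw [h]
  simp only [mul_assoc, gen_mul_self, mul_one]

theorem conj_dihedralRefl_right (b s : V) (i : ℤ) :
    racgGen G s * dihedralRefl (racgGen G b) (racgGen G s) i * racgGen G s =
      dihedralRefl (racgGen G b) (racgGen G s) (2 - i) := by
  have h := conj_zpow (i := -i) (a := racgGen G s) (b := racgGen G b * racgGen G s)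
  rw [mul_assoc, mul_assoc, gen_inv, gen_mul_self, mul_one, ← gen_mul_gen_inv, inv_zpow,
    ← zpow_neg, neg_neg] at h
  unfold dihedralRefl
  rw [show -(2 - i) = i + (-1) + (-1) by ring, zpow_add, zpow_add, h, zpow_neg_one,
    gen_mul_gen_inv]
  simp only [mul_assoc, gen_mul_self, mul_one, gen_mul_cancel_left]

theorem dihedralRefl_injective {b s : V} (hbs : b ≠ s) (h : ¬ G.Adj b s) :
    Function.Injective (dihedralRefl (racgGen G b) (racgGen G s)) := by
  classical
  let f : V → DihedralGroup 0 := fun v =>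
    if v = b then DihedralGroup.sr 0 else if v = s then DihedralGroup.sr 1 else 1
  obtain ⟨φ, hφ⟩ := exists_lift G f
    (fun v => by simp only [f]; split_ifs <;> simp)
    (fun u v huv => by
      simp only [f]
      split_ifs with h1 h2 h3 h4 h5 h6
      all_goals first
        | exact Commute.refl _
        | exact Commute.one_right _
        | exact Commute.one_left _
        | (subst_vars; exact absurd huv h)
        | (subst_vars; exact absurd huv.symm h))
  have key : ∀ i : ℤ, φ (dihedralRefl (racgGen G b) (racgGen G s) i) =
      DihedralGroup.sr (Int.cast i : ZMod 0) := by
    intro i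
    unfold dihedralRefl
    rw [map_mul, map_zpow, map_mul, hφ, hφ]
    have h0 : f b = DihedralGroup.sr 0 := if_pos rfl
    have h1 : f s = DihedralGroup.sr 1 := by simp [f, hbs.symm]
    rw [h0, h1, DihedralGroup.sr_mul_sr, sub_zero, DihedralGroup.r_one_zpow]
    simp only [DihedralGroup.r_mul_sr, Int.cast_neg, sub_neg_eq_add, zero_add]
  intro i j hij
  have h2 := congrArg φ hij
  rw [key, key] at h2
  exact Int.cast_injective (α := ZMod 0) (DihedralGroup.sr.inj h2)

theorem dihedralRefl_zero (b s : RACG G) : dihedralRefl b s 0 = b := by simp [dihedralRefl]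

theorem dihedralRefl_one (b s : V) :
    dihedralRefl (racgGen G b) (racgGen G s) 1 = racgGen G s := by
  unfold dihedralRefl
  rw [zpow_neg_one, gen_mul_gen_inv, mul_assoc, gen_mul_self, mul_one]

open Classical in
/-- The dihedral reflections whose walls separate the identity from an element of the dihedral
subgroup form an interval ending next to the identity. -/
theorem side_dihedralRefl {b s : V} (hbs : b ≠ s) (h : ¬ G.Adj b s) {d : RACG G}
    (hd : d ∈ Subgroup.closure {racgGen G b, racgGen G s}) :
    ∃ m : ℤ, ∀ i : ℤ, side G d (dihedralRefl (racgGen G b) (racgGen G s) i) =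
      if (1 ≤ i ∧ i ≤ m) ∨ (m < i ∧ i ≤ 0) then 1 else 0 := by
  have hinj := dihedralRefl_injective hbs h
  have hb : ∀ i : ℤ, eqInd (dihedralRefl (racgGen G b) (racgGen G s) i) (racgGen G b) =
      eqInd i 0 := fun i => eqInd_congr (by
    rw [← hinj.eq_iff (b := 0), dihedralRefl_zero])
  have hs : ∀ i : ℤ, eqInd (dihedralRefl (racgGen G b) (racgGen G s) i) (racgGen G s) =
      eqInd i 1 := fun i => eqInd_congr (by
    rw [← hinj.eq_iff (b := 1), dihedralRefl_one])
  have step : ∀ x ∈ ({racgGen G b, racgGen G s} : Set (RACG G)), ∀ y : RACG G,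
      (∃ m : ℤ, ∀ i : ℤ, side G y (dihedralRefl (racgGen G b) (racgGen G s) i) =
        if (1 ≤ i ∧ i ≤ m) ∨ (m < i ∧ i ≤ 0) then 1 else 0) →
      ∃ m : ℤ, ∀ i : ℤ, side G (x * y) (dihedralRefl (racgGen G b) (racgGen G s) i) =
        if (1 ≤ i ∧ i ≤ m) ∨ (m < i ∧ i ≤ 0) then 1 else 0 := by
    rintro x (rfl | rfl) y ⟨m, hm⟩
    · refine ⟨-m - 1, fun i => ?_⟩
      rw [side_gen_mul, hb, conj_dihedralRefl_left, hm]
      unfold eqInd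
      split_ifs <;> first | omega | decide
    · refine ⟨1 - m, fun i => ?_⟩
      rw [side_gen_mul, hs, conj_dihedralRefl_right, hm]
      unfold eqInd
      split_ifs <;> first | omega | decide
  induction hd using Subgroup.closure_induction_left with
  | one =>
    refine ⟨0, fun i => ?_⟩
    rw [side_one, if_neg (by omega)]
  | mul_left x hx y _ ih => exact step x hx y ih
  | inv_mul_cancel x hx y _ ih =>
    have : x⁻¹ = x := by
      rcases hx with rfl | rfl <;> exact gen_inv G _
    rw [this]
    exact step x hx y ih

/-- Distinct left descents of an element are adjacent. -/
theorem adj_of_descents {z : RACG G} {b s : V} (hbs : b ≠ s)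
    (hb : side G z (racgGen G b) = 1) (hs : side G z (racgGen G s) = 1) : G.Adj b s := by
  by_contra hadj
  set H := Subgroup.closure {racgGen G b, racgGen G s}
  have hbH : racgGen G b ∈ H := Subgroup.subset_closure (by simp)
  have hsH : racgGen G s ∈ H := Subgroup.subset_closure (by simp)
  obtain ⟨d, hd, hmin⟩ := exists_min_nat (p := fun d => d ∈ H)
    (fun d => racgLen G (d⁻¹ * z)) ⟨1, H.one_mem⟩
  have h0 : ∀ r ∈ H, side G (d⁻¹ * z) r = 0 := by
    intro r hr
    rw [← zmod_two_ne_one]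
    intro h1
    have h2 := len_mul_lt_of_side h1
    have h3 := hmin (d * r⁻¹) (H.mul_mem hd (H.inv_mem hr))
    rw [mul_inv_rev, inv_inv, mul_assoc] at h3
    omega
  have h1 : ∀ r ∈ H, side G z r = side G d r := by
    intro r hr
    conv_lhs => rw [← mul_inv_cancel_left d z]
    rw [side_mul, h0 _ (H.mul_mem (H.mul_mem (H.inv_mem hd) hr) hd), add_zero]
  obtain ⟨m, hm⟩ := side_dihedralRefl hbs hadj hd
  have hm0 := hm 0
  have hm1 := hm 1
  rw [dihedralRefl_zero, ← h1 _ hbH, hb] at hm0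
  rw [dihedralRefl_one, ← h1 _ hsH, hs] at hm1
  split_ifs at hm0 hm1 <;> first | omega | simp at hm0 hm1

/-- A left descent `s` of an element conjugating a generator to `b`, and not having `b` as a left
descent, is adjacent to `b`. -/
theorem adj_of_conj {p : RACG G} {b c s : V} (h : p * racgGen G c = racgGen G b * p)
    (hb : side G p (racgGen G b) = 0) (hs : side G p (racgGen G s) = 1) : G.Adj b s := by
  have hbs : b ≠ s := by
    rintro rfl
    rw [hb] at hs
    exact absurd hs (by decide)
  refine adj_of_descents (z := racgGen G b * p) hbs ?_ ?_
  · rw [side_gen_mul_gen, hb, add_zero]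
  · rw [← h, side_mul, side_gen, hs, eqInd_of_ne, add_zero]
    intro h'
    rw [← h'] at h
    refine hbs (gen_injective G ?_)
    have h2 : racgGen G s * p = racgGen G b * p := by rw [← h]; group
    exact (mul_right_cancel h2).symm

/-- The walls separating two vertices of the carrier of a wall cross that wall. -/
theorem commute_of_side_of_conj {p : RACG G} {b c : V} (h : p * racgGen G c = racgGen G b * p)
    {r : RACG G} (hr : side G p r = 1) : Commute r (racgGen G b) := by
  induction hn : racgLen G p using Nat.strong_induction_on generalizing p r with | _ n ih =>
  subst hn
  obtain ⟨s, hs, hsb⟩ : ∃ s, side G p (racgGen G s) = 1 ∧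
      Commute (racgGen G s) (racgGen G b) := by
    rcases zmod_two_eq_zero_or_one (side G p (racgGen G b)) with hb | hb
    · have hp : p ≠ 1 := by
        rintro rfl
        rw [side_one] at hr
        exact absurd hr (by decide)
      obtain ⟨s, hs⟩ := exists_descent hp
      exact ⟨s, hs, (gen_commute G (adj_of_conj h hb hs)).symm⟩
    · exact ⟨b, hb, Commute.refl _⟩
  by_cases hrs : r = racgGen G s
  · rwa [hrs]
  have hside := side_gen_mul G s (racgGen G s * p) r
  rw [gen_mul_cancel_left, hr, eqInd_of_ne hrs, zero_add] at hside
  have hc := ih _ (len_mul_lt_of_side hs)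
    (by rw [mul_assoc, h, ← mul_assoc, hsb.eq, mul_assoc]) hside.symm rfl
  have hr' : r = racgGen G s * (racgGen G s * r * racgGen G s) * racgGen G s := by
    simp only [mul_assoc, gen_mul_self, mul_one, gen_mul_cancel_left]
  rw [hr']
  exact (hsb.mul_left hc).mul_left hsb

theorem commute_of_descent_of_len_le {g : RACG G} {s : V} (hg : g * g = 1)
    (hs : side G g (racgGen G s) = 1)
    (hmin : racgLen G g ≤ racgLen G (racgGen G s * g * racgGen G s)) :
    Commute (racgGen G s) g := by
  by_contra hne
  have h1 : side G (g * racgGen G s) (racgGen G s) = 1 := by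
    rw [side_mul, side_gen, hs, eqInd_of_ne, add_zero]
    intro h
    refine hne ?_
    calc racgGen G s * g = g * (g⁻¹ * racgGen G s * g) := by group
      _ = g * racgGen G s := by rw [h]
  have h2 := len_mul_lt_of_side h1
  have h3 := len_mul_lt_of_side hs
  have h4 := len_inv G (g * racgGen G s)
  rw [mul_inv_rev, gen_inv, inv_eq_of_mul_eq_one_left hg] at h4
  rw [← mul_assoc] at h2
  omega

theorem not_adj_of_cliqueFree (hG : G.CliqueFree 3) {a b c : V} (hab : G.Adj a b)
    (hac : G.Adj a c) : ¬ G.Adj b c := by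
  classical
  intro hbc
  exact hG {a, b, c} (SimpleGraph.is3Clique_triple_iff.2 ⟨hab, hac, hbc⟩)

/-- In the triangle-free case, a nontrivial element commuting with all its left descents is a
generator or the product of two adjacent generators. -/
theorem eq_of_commute_descents (hG : G.CliqueFree 3) {g : RACG G} (hg : g ≠ 1)
    (h : ∀ s, side G g (racgGen G s) = 1 → Commute (racgGen G s) g) :
    (∃ s, g = racgGen G s) ∨ ∃ s u, G.Adj s u ∧ g = racgGen G s * racgGen G u := by
  obtain ⟨s, hs⟩ := exists_descent hg
  obtain ⟨k, rfl⟩ : ∃ k, g = racgGen G s * k :=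
    ⟨racgGen G s * g, (gen_mul_cancel_left G s g).symm⟩
  by_cases hk : k = 1
  · exact Or.inl ⟨s, by rw [hk, mul_one]⟩
  have hsk : Commute (racgGen G s) k := by
    have := (Commute.refl (racgGen G s)).mul_right (h s hs)
    rwa [gen_mul_cancel_left] at this
  rw [side_gen_mul_gen, add_eq_left] at hs
  obtain ⟨u, hu⟩ := exists_descent hk
  have hsu : G.Adj s u := adj_of_conj hsk.eq.symm hs hu
  have huk : Commute (racgGen G u) k := by
    have := (gen_commute G hsu).symm.mul_right
      (h u (by rw [side_gen_mul_of_adj hsu, hu]))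
    rwa [gen_mul_cancel_left] at this
  obtain ⟨m, rfl⟩ : ∃ m, k = racgGen G u * m :=
    ⟨racgGen G u * k, (gen_mul_cancel_left G u k).symm⟩
  by_cases hm : m = 1
  · exact Or.inr ⟨s, u, hsu, by rw [hm, mul_one]⟩
  have hum : Commute (racgGen G u) m := by
    have := (Commute.refl (racgGen G u)).mul_right huk
    rwa [gen_mul_cancel_left] at this
  have hsm : Commute (racgGen G s) m := by
    have := (gen_commute G hsu).mul_right hsk
    rwa [gen_mul_cancel_left] at this
  rw [side_gen_mul_gen, add_eq_left] at hu
  rw [side_gen_mul_of_adj hsu.symm] at hs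
  obtain ⟨w, hw⟩ := exists_descent hm
  exact absurd (adj_of_conj hum.eq.symm hu hw)
    (not_adj_of_cliqueFree hG hsu (adj_of_conj hsm.eq.symm hs hw))

theorem conj_mul_self {g : RACG G} (hg : g * g = 1) (x : RACG G) :
    (x⁻¹ * g * x) * (x⁻¹ * g * x) = 1 := by
  rw [show (x⁻¹ * g * x) * (x⁻¹ * g * x) = x⁻¹ * (g * g) * x by group, hg]
  group

theorem involution_cases (hG : G.CliqueFree 3) {g : RACG G} (hg : g ≠ 1) (hg2 : g * g = 1) :
    IsReflection G g ∨
      ∃ x s u, G.Adj s u ∧ g = x * (racgGen G s * racgGen G u) * x⁻¹ := by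
  obtain ⟨x, -, hmin⟩ := exists_min_nat (p := fun _ => True)
    (fun x : RACG G => racgLen G (x⁻¹ * g * x)) ⟨1, trivial⟩
  have hne : x⁻¹ * g * x ≠ 1 := by
    intro h
    refine hg ?_
    calc g = x * (x⁻¹ * g * x) * x⁻¹ := by group
      _ = 1 := by rw [h]; group
  have hx : g = x * (x⁻¹ * g * x) * x⁻¹ := by group
  rcases eq_of_commute_descents hG hne fun s hs =>
    commute_of_descent_of_len_le (conj_mul_self hg2 x) hs (by
      refine (hmin (x * racgGen G s) trivial).trans_eq ?_
      rw [mul_inv_rev, gen_inv]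
      simp only [mul_assoc]) with ⟨s, hs⟩ | ⟨s, u, hsu, h⟩
  · rw [hs] at hx
    exact Or.inl ⟨x, s, hx⟩
  · rw [h] at hx
    exact Or.inr ⟨x, s, u, hsu, hx⟩

/-- In the triangle-free case, the centralizer of an edge product is the edge subgroup. -/
theorem centralizer_edge (hG : G.CliqueFree 3) {s u : V} (hsu : G.Adj s u) {y : RACG G}
    (hy : Commute y (racgGen G s * racgGen G u)) :
    y = 1 ∨ y = racgGen G s ∨ y = racgGen G u ∨ y = racgGen G s * racgGen G u := by
  have hc := gen_commute G hsu
  have key : ∀ y : RACG G, Commute y (racgGen G s * racgGen G u) →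
      side G y (racgGen G s) = 0 → side G y (racgGen G u) = 0 → y = 1 := by
    intro y hy hs hu
    by_contra hne
    obtain ⟨w, hw⟩ := exists_descent hne
    have hsw : s ≠ w := by
      rintro rfl
      rw [hs] at hw
      exact absurd hw (by decide)
    have huw : u ≠ w := by
      rintro rfl
      rw [hu] at hw
      exact absurd hw (by decide)
    have h1 : side G (racgGen G s * racgGen G u * y) (racgGen G s) = 1 := by
      rw [mul_assoc, side_gen_mul_gen, side_gen_mul_of_adj hsu.symm, hs, add_zero]
    have h2 : side G (racgGen G s * racgGen G u * y) (racgGen G u) = 1 := by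
      rw [hc.eq, mul_assoc, side_gen_mul_gen, side_gen_mul_of_adj hsu, hu, add_zero]
    have h3 : side G (racgGen G s * racgGen G u * y) (racgGen G w) = 1 := by
      rw [← hy.eq, ← mul_assoc, side_mul, side_mul, side_gen, side_gen, hw,
        eqInd_of_ne, eqInd_of_ne, add_zero, add_zero]
      · intro h
        refine huw (gen_eq_of_conj G (p := y * racgGen G s) ?_).symm
        rw [← h]
        group
      · intro h
        refine hsw (gen_eq_of_conj G (p := y) ?_).symm
        rw [← h]
        group
    exact not_adj_of_cliqueFree hG hsu (adj_of_descents hsw h1 h3) (adj_of_descents huw h2 h3)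
  have hs : Commute (racgGen G s) (racgGen G s * racgGen G u) := (Commute.refl _).mul_right hc
  have hu : Commute (racgGen G u) (racgGen G s * racgGen G u) :=
    hc.symm.mul_right (Commute.refl _)
  rcases zmod_two_eq_zero_or_one (side G y (racgGen G s)) with h1 | h1 <;>
    rcases zmod_two_eq_zero_or_one (side G y (racgGen G u)) with h2 | h2
  · exact Or.inl (key y hy h1 h2)
  · have h := key (racgGen G u * y) (hu.mul_left hy)
      (by rw [side_gen_mul_of_adj hsu.symm, h1]) (by rw [side_gen_mul_gen, h2]; rfl)
    rw [mul_eq_one_iff_inv_eq, gen_inv] at h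
    exact Or.inr (Or.inr (Or.inl h.symm))
  · have h := key (racgGen G s * y) (hs.mul_left hy)
      (by rw [side_gen_mul_gen, h1]; rfl) (by rw [side_gen_mul_of_adj hsu, h2])
    rw [mul_eq_one_iff_inv_eq, gen_inv] at h
    exact Or.inr (Or.inl h.symm)
  · have h := key (racgGen G u * (racgGen G s * y)) (hu.mul_left (hs.mul_left hy))
      (by rw [side_gen_mul_of_adj hsu.symm, side_gen_mul_gen, h1]; rfl)
      (by rw [side_gen_mul_gen, side_gen_mul_of_adj hsu, h2]; rfl)
    rw [mul_eq_one_iff_inv_eq, gen_inv] at h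
    exact Or.inr (Or.inr (Or.inr (by rw [h, gen_mul_cancel_left])))

theorem _root_.IsReflection.ne_one {t : RACG G} (ht : IsReflection G t) : t ≠ 1 := by
  rintro rfl
  have := side_self ht
  rw [side_one] at this
  exact absurd this (by decide)

/-- The carriers of the walls of two commuting reflections share a vertex. -/
theorem exists_common_carrier (hG : G.CliqueFree 3) {t t' : RACG G} (ht : IsReflection G t)
    (ht' : IsReflection G t') (h : Commute t t') :
    ∃ x a b, x⁻¹ * t * x = racgGen G a ∧ x⁻¹ * t' * x = racgGen G b := by
  obtain ⟨g, b, rfl⟩ := ht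
  obtain ⟨x, hx, hmin⟩ := exists_min_nat (p := fun x => Commute x (racgGen G b))
    (fun x : RACG G => racgLen G ((g * x)⁻¹ * t' * (g * x))) ⟨1, Commute.one_left _⟩
  have hb : racgGen G b = (g * x)⁻¹ * (g * racgGen G b * g⁻¹) * (g * x) := by
    rw [show (g * x)⁻¹ * (g * racgGen G b * g⁻¹) * (g * x) = x⁻¹ * (racgGen G b * x) by group,
      ← hx.eq, inv_mul_cancel_left]
  have hr : IsReflection G ((g * x)⁻¹ * t' * (g * x)) := by
    simpa using ht'.conj (g * x)⁻¹
  have hcomm : Commute ((g * x)⁻¹ * t' * (g * x)) (racgGen G b) := by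
    have h' := (Commute.conj_iff (g * x)⁻¹).2 h.symm
    rwa [inv_inv, ← hb] at h'
  refine ⟨g * x, b, ?_⟩
  rcases eq_of_commute_descents hG hr.ne_one fun s hs =>
    commute_of_descent_of_len_le hr.mul_self hs (by
      have hsb : Commute (racgGen G s) (racgGen G b) := by
        by_cases hbs : b = s
        · rw [hbs]
        refine (gen_commute G ?_).symm
        rcases zmod_two_eq_zero_or_one
          (side G ((g * x)⁻¹ * t' * (g * x)) (racgGen G b)) with h0 | h1
        · exact adj_of_conj hcomm.eq h0 hs
        · exact adj_of_descents hbs h1 hs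
      refine (hmin (x * racgGen G s) (hx.mul_left hsb)).trans_eq ?_
      rw [← mul_assoc g, mul_inv_rev (g * x), gen_inv]
      simp only [mul_assoc]) with ⟨s, hs⟩ | ⟨s, u, hsu, h⟩
  · exact ⟨s, hb.symm, hs⟩
  · rw [h] at hr
    exact absurd hr (gen_mul_gen_not_isReflection G s u)

theorem not_commute_of_separates {t t' : RACG G} (ht : IsReflection G t)
    (ht' : IsReflection G t') (h : SeparatesFromWall G t t') : ¬ Commute t t' := by
  intro hc
  obtain ⟨x, v, rfl⟩ := ht'
  have h1 := h x ⟨v, by group⟩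
  have h2 := h (t * x) ⟨v, by
    rw [mul_inv_rev, mul_assoc, mul_assoc, ← mul_assoc _ t x, ← hc.eq]
    group⟩
  rw [← mul_assoc, ht.mul_self, one_mul] at h2
  omega

/-- If `t` separates the identity from a wall, then also from every wall that crosses the latter
and does not cross the wall of `t`. -/
theorem separates_of_commute (hG : G.CliqueFree 3) {t t₁ t₂ : RACG G} (ht : IsReflection G t)
    (ht₁ : IsReflection G t₁) (ht₂ : IsReflection G t₂) (h : SeparatesFromWall G t t₁)
    (h₁₂ : Commute t₁ t₂) (h₂ : ¬ Commute t t₂) : SeparatesFromWall G t t₂ := by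
  obtain ⟨x, a, b, ha, hb⟩ := exists_common_carrier hG ht₁ ht₂ h₁₂
  have hx := (side_eq_one_iff ht).2 (h x ⟨a, ha⟩)
  rintro y ⟨v, hv⟩
  rw [← side_eq_one_iff ht, ← mul_inv_cancel_left x y, side_mul, hx, add_eq_left,
    ← zmod_two_ne_one]
  intro hside
  refine h₂ ?_
  have hconj := commute_of_side_of_conj (p := x⁻¹ * y) (b := b) (c := v)
    (by rw [← hv, ← hb]; group) hside
  rw [← hb] at hconj
  have := (Commute.conj_iff x).2 hconj
  simpa [mul_assoc] using this

/-- The distance from the identity to the carrier of the wall of a reflection. -/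
noncomputable def wallDist (G : SimpleGraph V) (t : RACG G) : ℕ :=
  sInf {n | ∃ x v, racgLen G x = n ∧ x⁻¹ * t * x = racgGen G v}

theorem wallDist_conj_lt {t t' : RACG G} (ht' : IsReflection G t')
    (h : SeparatesFromWall G t t') : wallDist G (t * t' * t⁻¹) < wallDist G t' := by
  obtain ⟨x, v, hx, hv⟩ := Nat.sInf_mem
    (s := {n | ∃ x v, racgLen G x = n ∧ x⁻¹ * t' * x = racgGen G v}) (by
      obtain ⟨g, v, rfl⟩ := ht'
      exact ⟨_, g, v, rfl, by group⟩)
  have hlt := h x ⟨v, hv⟩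
  rw [hx] at hlt
  refine lt_of_le_of_lt (Nat.sInf_le ⟨t * x, v, rfl, ?_⟩) hlt
  rw [← hv]
  group

end Basic

section Embedding

variable {U V : Type*} {Φ : SimpleGraph U} {Ψ : SimpleGraph V}

/-- An involutive self-map on generators compatible with the relations is an automorphism. -/
theorem exists_involutive_aut (f : U → RACG Φ) (hsq : ∀ v, f v * f v = 1)
    (hcomm : ∀ u v, Φ.Adj u v → Commute (f u) (f v))
    (hinv : ∀ φ : RACG Φ →* RACG Φ, (∀ v, φ (racgGen Φ v) = f v) →
      ∀ v, φ (f v) = racgGen Φ v) :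
    ∃ α : RACG Φ ≃* RACG Φ, ∀ v, α (racgGen Φ v) = f v := by
  obtain ⟨φ, hφ⟩ := exists_lift Φ f hsq hcomm
  have h : φ.comp φ = MonoidHom.id _ := hom_ext Φ fun v => by
    rw [MonoidHom.comp_apply, hφ, hinv φ hφ, MonoidHom.id_apply]
  exact ⟨φ.toMulEquiv φ h h, hφ⟩

/-- If a generator with a neighbour is not sent to a reflection, then its neighbour is unique, and
is sent to a reflection, as is the product of the two. -/
theorem neighbor_of_not_isReflection (hΨ : Ψ.CliqueFree 3) {ρ : RACG Φ →* RACG Ψ}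
    (hρ : Function.Injective ρ) {v w : U} (hvw : Φ.Adj v w)
    (hv : ¬ IsReflection Ψ (ρ (racgGen Φ v))) :
    IsReflection Ψ (ρ (racgGen Φ w)) ∧ IsReflection Ψ (ρ (racgGen Φ v * racgGen Φ w)) ∧
      ∀ w', Φ.Adj v w' → w' = w := by
  have hne : ρ (racgGen Φ v) ≠ 1 := fun h =>
    gen_ne_one Φ v (hρ (by rw [h, map_one]))
  have hsq : ρ (racgGen Φ v) * ρ (racgGen Φ v) = 1 := by
    rw [← map_mul, gen_mul_self, map_one]
  obtain ⟨x, s, u, hsu, h⟩ := (involution_cases hΨ hne hsq).resolve_left hv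
  have hcomm := gen_commute Ψ hsu
  have key : ∀ w', Φ.Adj v w' → ρ (racgGen Φ w') = x * racgGen Ψ s * x⁻¹ ∨
      ρ (racgGen Φ w') = x * racgGen Ψ u * x⁻¹ := by
    intro w' hw'
    have hc := (Commute.conj_iff x⁻¹).2 ((gen_commute Φ hw').symm.map ρ)
    rw [h, show x⁻¹ * (x * (racgGen Ψ s * racgGen Ψ u) * x⁻¹) * x⁻¹⁻¹
      = racgGen Ψ s * racgGen Ψ u by group] at hc
    have hw : ρ (racgGen Φ w') = x * (x⁻¹ * ρ (racgGen Φ w') * x⁻¹⁻¹) * x⁻¹ := by group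
    rcases centralizer_edge hΨ hsu hc with h' | h' | h' | h' <;> rw [h'] at hw
    · rw [mul_one, mul_inv_cancel] at hw
      exact absurd (hρ (hw.trans (map_one ρ).symm)) (gen_ne_one Φ w')
    · exact Or.inl hw
    · exact Or.inr hw
    · exact absurd (gen_injective Φ (hρ (h.trans hw.symm))) hw'.ne
  have hprod : ∀ w', Φ.Adj v w' → ∀ w'', Φ.Adj v w'' →
      ρ (racgGen Φ w') = x * racgGen Ψ s * x⁻¹ →
      ρ (racgGen Φ w'') = x * racgGen Ψ u * x⁻¹ → False := by
    intro w' hw' w'' _ h1 h2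
    have h3 : racgGen Φ v * racgGen Φ w' = racgGen Φ w'' := hρ (by
      rw [map_mul, h, h1, h2, hcomm.eq, show
        x * (racgGen Ψ u * racgGen Ψ s) * x⁻¹ * (x * racgGen Ψ s * x⁻¹)
          = x * racgGen Ψ u * (racgGen Ψ s * racgGen Ψ s) * x⁻¹ by group, gen_mul_self, mul_one])
    exact gen_mul_gen_not_isReflection Φ v w' (h3 ▸ isReflection_gen Φ w'')
  refine ⟨?_, ?_, fun w' hw' => ?_⟩
  · rcases key w hvw with h1 | h1
    · exact ⟨x, s, h1⟩
    · exact ⟨x, u, h1⟩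
  · rw [map_mul, h]
    rcases key w hvw with h1 | h1 <;> rw [h1]
    · refine ⟨x, u, ?_⟩
      rw [hcomm.eq, show
        x * (racgGen Ψ u * racgGen Ψ s) * x⁻¹ * (x * racgGen Ψ s * x⁻¹)
          = x * racgGen Ψ u * (racgGen Ψ s * racgGen Ψ s) * x⁻¹ by group, gen_mul_self, mul_one]
    · refine ⟨x, s, ?_⟩
      rw [show
        x * (racgGen Ψ s * racgGen Ψ u) * x⁻¹ * (x * racgGen Ψ u * x⁻¹)
          = x * racgGen Ψ s * (racgGen Ψ u * racgGen Ψ u) * x⁻¹ by group, gen_mul_self, mul_one]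
  · rcases key w hvw with h1 | h1 <;> rcases key w' hw' with h2 | h2
    · exact gen_injective Φ (hρ (h2.trans h1.symm))
    · exact (hprod w hvw w' hw' h1 h2).elim
    · exact (hprod w' hw' w hvw h2 h1).elim
    · exact gen_injective Φ (hρ (h2.trans h1.symm))

/-- After composing with leaf transvections, an embedding sends generators to reflections. -/
theorem exists_aut_isReflection (hΨ : Ψ.CliqueFree 3) (hΦ : ∀ v : U, ∃ w : U, Φ.Adj v w)
    {ρ : RACG Φ →* RACG Ψ} (hρ : Function.Injective ρ) :
    ∃ α : RACG Φ ≃* RACG Φ, ∀ v, IsReflection Ψ (ρ (α (racgGen Φ v))) := by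
  classical
  choose n hn using hΦ
  let f : U → RACG Φ := fun v =>
    if IsReflection Ψ (ρ (racgGen Φ v)) then racgGen Φ v else racgGen Φ v * racgGen Φ (n v)
  have hgood : ∀ v, IsReflection Ψ (ρ (racgGen Φ v)) → f v = racgGen Φ v := fun v h => if_pos h
  have hbad : ∀ v, ¬ IsReflection Ψ (ρ (racgGen Φ v)) →
      f v = racgGen Φ v * racgGen Φ (n v) := fun v h => if_neg h
  have hedge : ∀ u v, Φ.Adj u v → ¬ IsReflection Ψ (ρ (racgGen Φ u)) →
      Commute (f u) (f v) := by
    intro u v huv hu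
    obtain ⟨-, -, huniq⟩ := neighbor_of_not_isReflection hΨ hρ (hn u) hu
    obtain ⟨h1, -, -⟩ := neighbor_of_not_isReflection hΨ hρ huv hu
    rw [hgood v h1, hbad u hu, ← huniq v huv]
    exact (gen_commute Φ huv).mul_left (Commute.refl _)
  obtain ⟨α, hα⟩ := exists_involutive_aut f (fun v => by
      by_cases hv : IsReflection Ψ (ρ (racgGen Φ v))
      · rw [hgood v hv, gen_mul_self]
      · rw [hbad v hv, (gen_commute Φ (hn v)).symm.mul_mul_mul_comm, gen_mul_self, gen_mul_self,
          mul_one])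
    (fun u v huv => by
      by_cases hu : IsReflection Ψ (ρ (racgGen Φ u))
      · by_cases hv : IsReflection Ψ (ρ (racgGen Φ v))
        · rw [hgood u hu, hgood v hv]
          exact gen_commute Φ huv
        · exact (hedge v u huv.symm hv).symm
      · exact hedge u v huv hu)
    (fun φ hφ v => by
      by_cases hv : IsReflection Ψ (ρ (racgGen Φ v))
      · rw [hgood v hv, hφ, hgood v hv]
      · rw [hbad v hv, map_mul, hφ, hφ, hbad v hv,
          hgood _ (neighbor_of_not_isReflection hΨ hρ (hn v) hv).1, mul_assoc, gen_mul_self,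
          mul_one])
  refine ⟨α, fun v => ?_⟩
  rw [hα]
  by_cases hv : IsReflection Ψ (ρ (racgGen Φ v))
  · rwa [hgood v hv]
  · rw [hbad v hv]
    exact (neighbor_of_not_isReflection hΨ hρ (hn v) hv).2.1

/-- The partial conjugation by `v` of all generators whose walls are separated from the identity
by the wall of `v`. -/
theorem exists_partial_conj (hΨ : Ψ.CliqueFree 3) {ρ : RACG Φ →* RACG Ψ}
    (hρ : Function.Injective ρ) (hrefl : ∀ v, IsReflection Ψ (ρ (racgGen Φ v))) (v : U) :
    ∃ α : RACG Φ ≃* RACG Φ, ∀ w,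
      (SeparatesFromWall Ψ (ρ (racgGen Φ v)) (ρ (racgGen Φ w)) →
        α (racgGen Φ w) = racgGen Φ v * racgGen Φ w * (racgGen Φ v)⁻¹) ∧
      (¬ SeparatesFromWall Ψ (ρ (racgGen Φ v)) (ρ (racgGen Φ w)) →
        α (racgGen Φ w) = racgGen Φ w) := by
  classical
  let A : U → Prop := fun w => SeparatesFromWall Ψ (ρ (racgGen Φ v)) (ρ (racgGen Φ w))
  let f : U → RACG Φ := fun w =>
    if A w then racgGen Φ v * racgGen Φ w * (racgGen Φ v)⁻¹ else racgGen Φ w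
  have hmem : ∀ w, A w → f w = racgGen Φ v * racgGen Φ w * (racgGen Φ v)⁻¹ :=
    fun w h => if_pos h
  have hnot : ∀ w, ¬ A w → f w = racgGen Φ w := fun w h => if_neg h
  have hv : ¬ A v := fun h =>
    not_commute_of_separates (hrefl v) (hrefl v) h (Commute.refl _)
  have hedge : ∀ a b, Φ.Adj a b → A a → ¬ A b → Commute (f a) (f b) := by
    intro a b hab ha hb
    have hvb : Commute (racgGen Φ v) (racgGen Φ b) := by
      by_contra hne
      refine hb (separates_of_commute hΨ (hrefl v) (hrefl a) (hrefl b) ha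
        ((gen_commute Φ hab).map ρ) fun hc => hne (hρ ?_))
      rw [map_mul, map_mul, hc.eq]
    rw [hmem a ha, hnot b hb]
    exact (hvb.mul_left (gen_commute Φ hab)).mul_left hvb.inv_left
  obtain ⟨α, hα⟩ := exists_involutive_aut f (fun w => by
      by_cases hw : A w
      · rw [hmem w hw, show
          racgGen Φ v * racgGen Φ w * (racgGen Φ v)⁻¹ *
            (racgGen Φ v * racgGen Φ w * (racgGen Φ v)⁻¹) =
          racgGen Φ v * (racgGen Φ w * racgGen Φ w) * (racgGen Φ v)⁻¹ by group, gen_mul_self]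
        group
      · rw [hnot w hw, gen_mul_self])
    (fun a b hab => by
      by_cases ha : A a <;> by_cases hb : A b
      · rw [hmem a ha, hmem b hb]
        exact (Commute.conj_iff _).2 (gen_commute Φ hab)
      · exact hedge a b hab ha hb
      · exact (hedge b a hab.symm hb ha).symm
      · rw [hnot a ha, hnot b hb]
        exact gen_commute Φ hab)
    (fun φ hφ w => by
      by_cases hw : A w
      · rw [hmem w hw, map_mul, map_mul, map_inv, hφ, hφ, hnot v hv, hmem w hw, gen_inv]
        simp only [mul_assoc, gen_mul_self, mul_one, gen_mul_cancel_left]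
      · rw [hnot w hw, hφ, hnot w hw])
  exact ⟨α, fun w => ⟨fun h => (hα w).trans (hmem w h), fun h => (hα w).trans (hnot w h)⟩⟩

end Embedding

end RACG

theorem racg_embedding_peripheral {VΦ VΨ : Type*} [Fintype VΦ] [Fintype VΨ]
    (Φ : SimpleGraph VΦ) (Ψ : SimpleGraph VΨ) (hΨ : Ψ.CliqueFree 3)
    (hΦ : ∀ v : VΦ, ∃ w : VΦ, Φ.Adj v w)
    (ρ : RACG Φ →* RACG Ψ) (hρ : Function.Injective ρ) :
    ∃ α : RACG Φ ≃* RACG Φ,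
      (∀ v : VΦ, IsReflection Ψ (ρ (α (racgGen Φ v)))) ∧
      (Function.Injective fun v : VΦ => ρ (α (racgGen Φ v))) ∧
      ∀ v w : VΦ, v ≠ w →
        ¬ SeparatesFromWall Ψ (ρ (α (racgGen Φ v))) (ρ (α (racgGen Φ w))) := by
  obtain ⟨α₀, hα₀⟩ := RACG.exists_aut_isReflection hΨ hΦ hρ
  obtain ⟨α, hα, hmin⟩ := RACG.exists_min_nat
    (p := fun α : RACG Φ ≃* RACG Φ => ∀ v, IsReflection Ψ (ρ (α (racgGen Φ v))))
    (fun α => ∑ v, RACG.wallDist Ψ (ρ (α (racgGen Φ v)))) ⟨α₀, hα₀⟩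
  have hinj : Function.Injective (ρ.comp α.toMonoidHom) := hρ.comp α.injective
  refine ⟨α, hα, hinj.comp (RACG.gen_injective Φ), fun v w _ hsep => ?_⟩
  obtain ⟨π, hπ⟩ := RACG.exists_partial_conj hΨ hinj hα v
  have hconj : ∀ u, SeparatesFromWall Ψ (ρ (α (racgGen Φ v))) (ρ (α (racgGen Φ u))) →
      ρ ((π.trans α) (racgGen Φ u)) = ρ (α (racgGen Φ v)) * ρ (α (racgGen Φ u)) *
        (ρ (α (racgGen Φ v)))⁻¹ := by
    intro u hu
    rw [MulEquiv.trans_apply, (hπ u).1 hu]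
    simp only [map_mul, map_inv]
  have hfix : ∀ u, ¬ SeparatesFromWall Ψ (ρ (α (racgGen Φ v))) (ρ (α (racgGen Φ u))) →
      ρ ((π.trans α) (racgGen Φ u)) = ρ (α (racgGen Φ u)) := by
    intro u hu
    rw [MulEquiv.trans_apply, (hπ u).2 hu]
  have hlt := RACG.wallDist_conj_lt (hα w) hsep
  rw [← hconj w hsep] at hlt
  refine absurd (hmin (π.trans α) fun u => ?_) (not_le.2 (Finset.sum_lt_sum (fun u _ => ?_)
    ⟨w, Finset.mem_univ w, hlt⟩))
  · by_cases hu : SeparatesFromWall Ψ (ρ (α (racgGen Φ v))) (ρ (α (racgGen Φ u)))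
    · rw [hconj u hu]
      exact (hα u).conj _
    · rw [hfix u hu]
      exact hα u
  · by_cases hu : SeparatesFromWall Ψ (ρ (α (racgGen Φ v))) (ρ (α (racgGen Φ u)))
    · rw [hconj u hu]
      exact (RACG.wallDist_conj_lt (hα u) hu).le
    · rw [hfix u hu]
end
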